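/- arXiv:1004.2947 — 5 statements merged into one kernel-verified Lean document; each statement's English description precedes it below -/
import Mathlib

section
/- For all u, v ∈ C¹([a,b]) with u(a) = u(b) = v(a) = v(b) = 0 one has |A(u,v)| ≤ c₁ ‖u'‖ ‖v'‖, where c₁ = σ²/2 + c₂(μ max(|a|,|b|) + 2λ c₂) and c₂ = (b−a)/π. -/
open MeasureTheory

/-- The `L²(a,b)` norm of a function. -/
noncomputable def L2norm (a b : ℝ) (v : ℝ → ℝ) : ℝ :=
  Real.sqrt (∫ x in a..b, (v x) ^ 2)

/-- The integral operator `𝓘v(x) = λ(∫_a^b φ(x−y) v(y) dy − v(x))`. -/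
noncomputable def Iop (a b lam : ℝ) (φ v : ℝ → ℝ) : ℝ → ℝ :=
  fun x => lam * ((∫ y in a..b, φ (x - y) * v y) - v x)

/-- The bilinear form
`A(u,v) = ∫_a^b ((σ²/2) u' v' + μ x u' v) dx − ∫_a^b 𝓘u v dx`,
expressed in terms of prescribed derivatives `u'`, `v'`. -/
noncomputable def Abil (a b σ μ lam : ℝ) (φ u u' v v' : ℝ → ℝ) : ℝ :=
  (∫ x in a..b, ((σ ^ 2 / 2) * u' x * v' x + μ * x * u' x * v x)) -
    ∫ x in a..b, Iop a b lam φ u x * v x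

/-- The discriminant argument behind the Cauchy–Schwarz inequality. -/
theorem abs_le_sqrt_mul_sqrt_of_quadratic_nonneg {P B Q : ℝ} (hP : 0 ≤ P)
    (h : ∀ s : ℝ, 0 ≤ s ^ 2 * P + 2 * s * B + Q) : |B| ≤ √P * √Q := by
  have hd : discrim P (2 * B) Q ≤ 0 := discrim_le_zero fun s => by linarith [h s]
  rw [← Real.sqrt_mul hP]
  refine Real.abs_le_sqrt ?_
  rw [discrim] at hd
  linarith

theorem L2norm_nonneg (a b : ℝ) (f : ℝ → ℝ) : 0 ≤ L2norm a b f := Real.sqrt_nonneg _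

theorem abs_integral_mul_le_L2norm_mul_L2norm {a b : ℝ} (hab : a ≤ b) {f g : ℝ → ℝ}
    (hf : ContinuousOn f (Set.Icc a b)) (hg : ContinuousOn g (Set.Icc a b)) :
    |∫ x in a..b, f x * g x| ≤ L2norm a b f * L2norm a b g := by
  refine abs_le_sqrt_mul_sqrt_of_quadratic_nonneg
    (intervalIntegral.integral_nonneg hab fun x _ => sq_nonneg _) fun s => ?_
  have hff : IntervalIntegrable (fun x => s ^ 2 * f x ^ 2) volume a b :=
    ((hf.pow 2).const_mul _).intervalIntegrable_of_Icc hab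
  have hfg : IntervalIntegrable (fun x => 2 * s * (f x * g x)) volume a b :=
    ((hf.mul hg).const_mul _).intervalIntegrable_of_Icc hab
  have hgg : IntervalIntegrable (fun x => g x ^ 2) volume a b :=
    (hg.pow 2).intervalIntegrable_of_Icc hab
  rw [← intervalIntegral.integral_const_mul, ← intervalIntegral.integral_const_mul,
    ← intervalIntegral.integral_add hff hfg, ← intervalIntegral.integral_add (hff.add hfg) hgg]
  exact intervalIntegral.integral_nonneg hab fun x _ => by nlinarith [sq_nonneg (s * f x + g x)]

theorem sq_mul_integral_sq_le_integral_deriv_sq {a b k : ℝ} (hab : a < b) (hk : 0 < k)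
    (hkab : k < Real.pi / (b - a)) {v v' : ℝ → ℝ} (hva : v a = 0) (hvb : v b = 0)
    (hv : ∀ x ∈ Set.Icc a b, HasDerivWithinAt v (v' x) (Set.Icc a b) x)
    (hv'c : ContinuousOn v' (Set.Icc a b)) :
    k ^ 2 * ∫ x in a..b, v x ^ 2 ≤ ∫ x in a..b, v' x ^ 2 := by
  have hkL : k * (b - a) < Real.pi := (lt_div_iff₀ (sub_pos.2 hab)).1 hkab
  have hvc : ContinuousOn v (Set.Icc a b) := fun x hx => (hv x hx).continuousWithinAt
  set t : ℝ → ℝ := fun x => k * Real.tan (k * (x - (a + b) / 2)) with ht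
  have hcos : ∀ x ∈ Set.Icc a b, Real.cos (k * (x - (a + b) / 2)) ≠ 0 := fun x hx =>
    (Real.cos_pos_of_mem_Ioo ⟨by nlinarith [hx.1], by nlinarith [hx.2]⟩).ne'
  have htd : ∀ x ∈ Set.Icc a b, HasDerivAt t (k ^ 2 + t x ^ 2) x := fun x hx => by
    have h1 : HasDerivAt (fun x => k * (x - (a + b) / 2)) (k * 1) x :=
      ((hasDerivAt_id x).sub_const _).const_mul k
    have h2 := ((Real.hasDerivAt_tan (hcos x hx)).comp x h1).const_mul k
    refine h2.congr_deriv ?_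
    have h3 := Real.one_add_tan_sq_mul_cos_sq_eq_one (hcos x hx)
    have h4 : 1 / Real.cos (k * (x - (a + b) / 2)) ^ 2
        = 1 + Real.tan (k * (x - (a + b) / 2)) ^ 2 := by
      rw [div_eq_iff (pow_ne_zero 2 (hcos x hx)), h3]
    rw [h4, ht]
    ring
  have htc : ContinuousOn t (Set.Icc a b) := fun x hx => (htd x hx).continuousAt.continuousWithinAt
  have hG : ∫ x in a..b, ((k ^ 2 + t x ^ 2) * v x ^ 2 + t x * (2 * v x * v' x)) = 0 := by
    rw [intervalIntegral.integral_eq_sub_of_hasDerivAt_of_le (f := fun x => t x * v x ^ 2) hab.le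
      (htc.mul (hvc.pow 2))]
    · simp [hva, hvb]
    · intro x hx
      have hd := (hv x (Set.Ioo_subset_Icc_self hx)).hasDerivAt (Icc_mem_nhds hx.1 hx.2)
      refine ((htd x (Set.Ioo_subset_Icc_self hx)).mul (hd.pow 2)).congr_deriv ?_
      simp
    · exact ContinuousOn.intervalIntegrable_of_Icc hab.le (by fun_prop)
  have h1 : IntervalIntegrable (fun x => v' x ^ 2) volume a b :=
    ContinuousOn.intervalIntegrable_of_Icc hab.le (by fun_prop)
  have h2 : IntervalIntegrable (fun x => k ^ 2 * v x ^ 2) volume a b :=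
    ContinuousOn.intervalIntegrable_of_Icc hab.le (by fun_prop)
  have h3 : IntervalIntegrable
      (fun x => (k ^ 2 + t x ^ 2) * v x ^ 2 + t x * (2 * v x * v' x)) volume a b :=
    ContinuousOn.intervalIntegrable_of_Icc hab.le (by fun_prop)
  rw [← intervalIntegral.integral_const_mul, ← add_zero (∫ x in a..b, v' x ^ 2), ← hG,
    ← intervalIntegral.integral_add h1 h3]
  exact intervalIntegral.integral_mono_on hab.le h2 (h1.add h3) fun x _ => by
    nlinarith [sq_nonneg (v' x + t x * v x)]

/-- Poincaré's inequality on an interval, with the optimal constant. -/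
theorem L2norm_le_mul_L2norm_deriv {a b : ℝ} (hab : a < b) {v v' : ℝ → ℝ}
    (hva : v a = 0) (hvb : v b = 0)
    (hv : ∀ x ∈ Set.Icc a b, HasDerivWithinAt v (v' x) (Set.Icc a b) x)
    (hv'c : ContinuousOn v' (Set.Icc a b)) :
    L2norm a b v ≤ (b - a) / Real.pi * L2norm a b v' := by
  have hL : 0 < b - a := sub_pos.2 hab
  have hK : 0 < Real.pi / (b - a) := div_pos Real.pi_pos hL
  have hlim : (Real.pi / (b - a)) ^ 2 * ∫ x in a..b, v x ^ 2 ≤ ∫ x in a..b, v' x ^ 2 := by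
    have hc : Continuous fun k : ℝ => k ^ 2 * ∫ x in a..b, v x ^ 2 := by fun_prop
    refine le_of_tendsto ((hc.tendsto (Real.pi / (b - a))).mono_left
      (nhdsWithin_le_nhds (s := Set.Iio (Real.pi / (b - a))))) ?_
    filter_upwards [Ioo_mem_nhdsLT hK] with k hk
    exact sq_mul_integral_sq_le_integral_deriv_sq hab hk.1 hk.2 hva hvb hv hv'c
  have hs := Real.sqrt_le_sqrt hlim
  rw [Real.sqrt_mul (sq_nonneg _), Real.sqrt_sq hK.le] at hs
  rw [← inv_div, inv_mul_eq_div, le_div_iff₀' hK]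
  exact hs

/-- A special case of Young's convolution inequality, tested against an `L²` function. -/
theorem abs_integral_convolution_mul_le {a b : ℝ} (hab : a ≤ b) {φ u v : ℝ → ℝ}
    (hφc : Continuous φ) (hφ0 : ∀ y, 0 ≤ φ y) (hφ1 : (∫ y, φ y) = 1)
    (hu : Continuous u) (hv : Continuous v) :
    |∫ x in a..b, (∫ y in a..b, φ (x - y) * u y) * v x| ≤ L2norm a b u * L2norm a b v := by
  have hφi : Integrable φ := by
    by_contra h
    simp [integral_undef h] at hφ1
  have hmass : ∀ f : ℝ → ℝ, Integrable f → (∀ y, 0 ≤ f y) → (∫ y, f y) = 1 →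
      (∫ y in a..b, f y) ≤ 1 := fun f hf hf0 hf1 => by
    rw [intervalIntegral.integral_of_le hab, ← hf1]
    exact setIntegral_le_integral hf (Filter.Eventually.of_forall hf0)
  have hleft : ∀ x, (∫ y in a..b, φ (x - y)) ≤ 1 := fun x =>
    hmass _ (hφi.comp_sub_left x) (fun y => hφ0 _) (by rw [integral_sub_left_eq_self, hφ1])
  have hright : ∀ y, (∫ x in a..b, φ (x - y)) ≤ 1 := fun y =>
    hmass _ (hφi.comp_sub_right y) (fun x => hφ0 _) (by rw [integral_sub_right_eq_self, hφ1])
  refine abs_le_sqrt_mul_sqrt_of_quadratic_nonneg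
    (intervalIntegral.integral_nonneg hab fun x _ => sq_nonneg _) fun s => ?_
  have hc₁ : Continuous fun x => ∫ y in a..b, φ (x - y) * u y ^ 2 :=
    intervalIntegral.continuous_parametric_intervalIntegral_of_continuous'
      (by simp only [Function.uncurry_def]; fun_prop) _ _
  have hc₂ : Continuous fun x => ∫ y in a..b, φ (x - y) * u y :=
    intervalIntegral.continuous_parametric_intervalIntegral_of_continuous'
      (by simp only [Function.uncurry_def]; fun_prop) _ _
  have hc₃ : Continuous fun x => ∫ y in a..b, φ (x - y) :=
    intervalIntegral.continuous_parametric_intervalIntegral_of_continuous'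
      (by simp only [Function.uncurry_def]; fun_prop) _ _
  have hu2 : (∫ x in a..b, ∫ y in a..b, φ (x - y) * u y ^ 2) ≤ ∫ y in a..b, u y ^ 2 := by
    rw [intervalIntegral_intervalIntegral_swap]
    · refine intervalIntegral.integral_mono_on hab ?_ ((hu.pow 2).intervalIntegrable _ _) ?_
      · refine Continuous.intervalIntegrable ?_ _ _
        exact intervalIntegral.continuous_parametric_intervalIntegral_of_continuous'
          (by simp only [Function.uncurry_def]; fun_prop) _ _
      · intro y _
        rw [intervalIntegral.integral_mul_const]
        nlinarith [hright y, sq_nonneg (u y)]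
    · have hcont : Continuous (Function.uncurry fun x y => φ (x - y) * u y ^ 2) := by
        simp only [Function.uncurry_def]; fun_prop
      exact (hcont.continuousOn.integrableOn_compact
        (isCompact_uIcc.prod isCompact_uIcc)).mono_set
        (Set.prod_mono Set.uIoc_subset_uIcc Set.uIoc_subset_uIcc)
  have hpt : ∀ x, 0 ≤ s ^ 2 * (∫ y in a..b, φ (x - y) * u y ^ 2)
      + 2 * s * ((∫ y in a..b, φ (x - y) * u y) * v x) + v x ^ 2 := fun x => by
    have h0 : 0 ≤ ∫ y in a..b, φ (x - y) * (s * u y + v x) ^ 2 :=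
      intervalIntegral.integral_nonneg hab fun y _ => mul_nonneg (hφ0 _) (sq_nonneg _)
    have h1 : ∫ y in a..b, φ (x - y) * (s * u y + v x) ^ 2
        = s ^ 2 * (∫ y in a..b, φ (x - y) * u y ^ 2)
          + 2 * s * v x * (∫ y in a..b, φ (x - y) * u y)
          + v x ^ 2 * ∫ y in a..b, φ (x - y) := by
      rw [← intervalIntegral.integral_const_mul, ← intervalIntegral.integral_const_mul,
        ← intervalIntegral.integral_const_mul, ← intervalIntegral.integral_add,
        ← intervalIntegral.integral_add]
      · congr 1
        ext y
        ring
      all_goals exact Continuous.intervalIntegrable (by fun_prop) _ _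
    nlinarith [hleft x, sq_nonneg (v x)]
  have h0 := intervalIntegral.integral_nonneg (μ := volume) hab fun x _ => hpt x
  rw [intervalIntegral.integral_add, intervalIntegral.integral_add,
    intervalIntegral.integral_const_mul, intervalIntegral.integral_const_mul] at h0
  · nlinarith [sq_nonneg s]
  all_goals exact Continuous.intervalIntegrable (by fun_prop) _ _

theorem L2norm_mul_le_of_abs_le {a b M : ℝ} (hab : a ≤ b) (hM : 0 ≤ M) {m f : ℝ → ℝ}
    (hm : ContinuousOn m (Set.Icc a b)) (hmM : ∀ x ∈ Set.Icc a b, |m x| ≤ M)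
    (hf : ContinuousOn f (Set.Icc a b)) :
    L2norm a b (fun x => m x * f x) ≤ M * L2norm a b f := by
  rw [L2norm, L2norm, ← Real.sqrt_sq hM, ← Real.sqrt_mul (sq_nonneg _),
    ← intervalIntegral.integral_const_mul]
  refine Real.sqrt_le_sqrt (intervalIntegral.integral_mono_on hab
    (((hm.mul hf).pow 2).intervalIntegrable_of_Icc hab)
    (((hf.pow 2).const_mul _).intervalIntegrable_of_Icc hab) fun x hx => ?_)
  rw [mul_pow]
  exact mul_le_mul_of_nonneg_right (sq_le_sq.2 ((hmM x hx).trans (le_abs_self M))) (sq_nonneg _)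

theorem continuous_of_continuousOn_Icc_of_eq_zero {a b : ℝ} (hab : a < b) {u : ℝ → ℝ}
    (hu : ContinuousOn u (Set.Icc a b)) (hu0 : ∀ x, x ∉ Set.Ioo a b → u x = 0) :
    Continuous u := by
  rw [← Set.indicator_eq_self.2 (Function.support_subset_iff'.2 hu0)]
  refine continuous_indicator (fun x hx => hu0 x fun h => ?_) (by rwa [closure_Ioo hab.ne])
  rw [isOpen_Ioo.frontier_eq] at hx
  exact hx.2 h

/-- For all `u, v ∈ C¹([a,b])` vanishing at `a` and `b` (extended by zero):
`|A(u,v)| ≤ c₁ ‖u'‖ ‖v'‖` with `c₁ = σ²/2 + c₂(μ max(|a|,|b|) + 2λc₂)`, `c₂ = (b−a)/π`. -/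
theorem stmt4 (a b σ μ lam : ℝ) (hab : a < b) (hσ : 0 < σ) (hμ : 0 < μ) (hlam : 0 < lam)
    (φ : ℝ → ℝ) (hφc : Continuous φ) (hφ0 : ∀ y, 0 ≤ φ y) (hφ1 : (∫ y, φ y) = 1)
    (u u' v v' : ℝ → ℝ)
    (hu0 : ∀ x, x ∉ Set.Ioo a b → u x = 0)
    (hv0 : ∀ x, x ∉ Set.Ioo a b → v x = 0)
    (hu' : ∀ x ∈ Set.Icc a b, HasDerivWithinAt u (u' x) (Set.Icc a b) x)
    (hv' : ∀ x ∈ Set.Icc a b, HasDerivWithinAt v (v' x) (Set.Icc a b) x)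
    (hu'c : ContinuousOn u' (Set.Icc a b))
    (hv'c : ContinuousOn v' (Set.Icc a b)) :
    |Abil a b σ μ lam φ u u' v v'| ≤
      (σ ^ 2 / 2 + ((b - a) / Real.pi) * (μ * max |a| |b| + 2 * lam * ((b - a) / Real.pi))) *
        L2norm a b u' * L2norm a b v' := by
  have huC : ContinuousOn u (Set.Icc a b) := fun x hx => (hu' x hx).continuousWithinAt
  have hvC : ContinuousOn v (Set.Icc a b) := fun x hx => (hv' x hx).continuousWithinAt
  have huc := continuous_of_continuousOn_Icc_of_eq_zero hab huC hu0
  have hvc := continuous_of_continuousOn_Icc_of_eq_zero hab hvC hv0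
  have hu := L2norm_le_mul_L2norm_deriv hab (hu0 a (by simp)) (hu0 b (by simp)) hu' hu'c
  have hv := L2norm_le_mul_L2norm_deriv hab (hv0 a (by simp)) (hv0 b (by simp)) hv' hv'c
  have hM : 0 ≤ max |a| |b| := (abs_nonneg a).trans (le_max_left _ _)
  have hxu'c : ContinuousOn (fun x => x * u' x) (Set.Icc a b) := by fun_prop
  have hxu' := L2norm_mul_le_of_abs_le hab.le hM continuousOn_id
    (fun x hx => abs_le_max_abs_abs hx.1 hx.2) hu'c
  have hdiff := abs_integral_mul_le_L2norm_mul_L2norm hab.le hu'c hv'c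
  have hdrift := abs_integral_mul_le_L2norm_mul_L2norm hab.le hxu'c hvC
  have hmass := abs_integral_mul_le_L2norm_mul_L2norm hab.le huC hvC
  have hconv := abs_integral_convolution_mul_le hab.le hφc hφ0 hφ1 huc hvc
  have hKc : Continuous fun x => ∫ y in a..b, φ (x - y) * u y :=
    intervalIntegral.continuous_parametric_intervalIntegral_of_continuous'
      (by simp only [Function.uncurry_def]; fun_prop) _ _
  have hI : ∫ x in a..b, Iop a b lam φ u x * v x
      = lam * ((∫ x in a..b, (∫ y in a..b, φ (x - y) * u y) * v x) - ∫ x in a..b, u x * v x) := by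
    rw [← intervalIntegral.integral_sub, ← intervalIntegral.integral_const_mul]
    · simp only [Iop, mul_assoc, sub_mul]
    all_goals exact Continuous.intervalIntegrable (by fun_prop) _ _
  have hA : Abil a b σ μ lam φ u u' v v' = σ ^ 2 / 2 * (∫ x in a..b, u' x * v' x)
      + μ * (∫ x in a..b, x * u' x * v x)
      - lam * ((∫ x in a..b, (∫ y in a..b, φ (x - y) * u y) * v x)
        - ∫ x in a..b, u x * v x) := by
    rw [Abil, hI, ← intervalIntegral.integral_const_mul, ← intervalIntegral.integral_const_mul,
      ← intervalIntegral.integral_add]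
    · simp only [mul_assoc]
    all_goals exact ContinuousOn.intervalIntegrable_of_Icc hab.le (by fun_prop)
  set c := (b - a) / Real.pi with hc_def
  have hc : 0 ≤ c := div_nonneg (sub_nonneg.2 hab.le) Real.pi_pos.le
  have hU := L2norm_nonneg a b u'
  have hV := L2norm_nonneg a b v'
  have hdrift' := hdrift.trans (mul_le_mul hxu' hv (L2norm_nonneg a b v) (mul_nonneg hM hU))
  have huv := mul_le_mul hu hv (L2norm_nonneg a b v) (mul_nonneg hc hU)
  have hmass' := hmass.trans huv
  have hconv' := hconv.trans huv
  rw [hA]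
  calc _ ≤ σ ^ 2 / 2 * |∫ x in a..b, u' x * v' x| + μ * |∫ x in a..b, x * u' x * v x|
        + lam * (|∫ x in a..b, (∫ y in a..b, φ (x - y) * u y) * v x|
          + |∫ x in a..b, u x * v x|) := by
        refine (abs_sub _ _).trans (add_le_add ((abs_add_le _ _).trans (le_of_eq ?_)) ?_)
        · rw [abs_mul, abs_mul, abs_of_pos hμ, abs_of_nonneg (by positivity : 0 ≤ σ ^ 2 / 2)]
        · rw [abs_mul, abs_of_pos hlam]
          exact mul_le_mul_of_nonneg_left (abs_sub _ _) hlam.le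
    _ ≤ σ ^ 2 / 2 * (L2norm a b u' * L2norm a b v')
        + μ * (max |a| |b| * L2norm a b u' * (c * L2norm a b v'))
        + lam * (c * L2norm a b u' * (c * L2norm a b v')
          + c * L2norm a b u' * (c * L2norm a b v')) := by
        gcongr
    _ = _ := by ring
end

section
/- For every f ∈ C¹([a,b]) (in particular for f(x) = −μx) the boundary value problem 𝓛v − 𝓘v = f on (a,b), v = 0 outside (a,b), has exactly one classical solution v ∈ C²([a,b]). Moreover there exists a constant c₃ > 0, depending only on a, b, σ, μ, λ, such that every classical solution satisfies ‖v''‖_{L²(a,b)} ≤ c₃ ‖f‖_{L²(a,b)}. -/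
open MeasureTheory

/-- `v` is a classical solution of the boundary value problem `𝓛v − 𝓘v = f` on `(a,b)`,
`v = 0` outside `(a,b)`, where `𝓛v = −(σ²/2)v'' + μxv'`: `v ∈ C²([a,b])`, `v` vanishes
outside `(a,b)` (in particular `v(a) = v(b) = 0`), and the equation holds on `(a,b)`. -/
def IsClassicalSolution (a b σ μ lam : ℝ) (φ f v : ℝ → ℝ) : Prop :=
  (∀ x, x ∉ Set.Ioo a b → v x = 0) ∧
  ContDiffOn ℝ 2 v (Set.Icc a b) ∧
  ∀ x ∈ Set.Ioo a b,
    -(σ ^ 2 / 2) * deriv (deriv v) x + μ * x * deriv v x - Iop a b lam φ v x = f x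

open Set

/-- `u` is continuous on `[a,b]` and has first and second derivatives `u₁`, `u₂` on `(a,b)`. -/
structure HasTwoDerivs (a b : ℝ) (u u₁ u₂ : ℝ → ℝ) : Prop where
  cont : ContinuousOn u (Icc a b)
  fst : ∀ x ∈ Ioo a b, HasDerivAt u (u₁ x) x
  snd : ∀ x ∈ Ioo a b, HasDerivAt u₁ (u₂ x) x

/-- The truncated convolution `x ↦ ∫_a^b φ(x−y) u(y) dy`. -/
noncomputable def truncConv (a b : ℝ) (φ u : ℝ → ℝ) (x : ℝ) : ℝ :=
  ∫ y in a..b, φ (x - y) * u y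

/-- The normalized operator `−u'' + 2κxu' + s(u − φ ⋆ u)`, with `u'`, `u''` given as `u₁`, `u₂`. -/
noncomputable def diffJumpOp (a b κ s : ℝ) (φ u u₁ u₂ : ℝ → ℝ) (x : ℝ) : ℝ :=
  -u₂ x + 2 * κ * x * u₁ x + s * (u x - truncConv a b φ u x)

section

variable {a b κ s q : ℝ} {φ u u₁ u₂ v v₁ v₂ g : ℝ → ℝ}

theorem HasTwoDerivs.add (hu : HasTwoDerivs a b u u₁ u₂) (hv : HasTwoDerivs a b v v₁ v₂) :
    HasTwoDerivs a b (fun x => u x + v x) (fun x => u₁ x + v₁ x) (fun x => u₂ x + v₂ x) :=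
  ⟨hu.cont.add hv.cont, fun x hx => (hu.fst x hx).add (hv.fst x hx),
    fun x hx => (hu.snd x hx).add (hv.snd x hx)⟩

theorem HasTwoDerivs.const_mul (c : ℝ) (hu : HasTwoDerivs a b u u₁ u₂) :
    HasTwoDerivs a b (fun x => c * u x) (fun x => c * u₁ x) (fun x => c * u₂ x) :=
  ⟨continuousOn_const.mul hu.cont, fun x hx => (hu.fst x hx).const_mul c,
    fun x hx => (hu.snd x hx).const_mul c⟩

theorem truncConv_intervalIntegrable (hab : a ≤ b) (hφ : Continuous φ)
    (hu : ContinuousOn u (Icc a b)) (x : ℝ) :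
    IntervalIntegrable (fun y => φ (x - y) * u y) volume a b := by
  apply ContinuousOn.intervalIntegrable
  rw [uIcc_of_le hab]
  exact (by fun_prop : Continuous fun y => φ (x - y)).continuousOn.mul hu

theorem truncConv_add (hab : a ≤ b) (hφ : Continuous φ)
    (hu : ContinuousOn u (Icc a b)) (hv : ContinuousOn v (Icc a b)) (x : ℝ) :
    truncConv a b φ (fun y => u y + v y) x = truncConv a b φ u x + truncConv a b φ v x := by
  unfold truncConv
  rw [← intervalIntegral.integral_add (truncConv_intervalIntegrable hab hφ hu x)
    (truncConv_intervalIntegrable hab hφ hv x)]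
  simp only [mul_add]

theorem truncConv_const_mul (c x : ℝ) :
    truncConv a b φ (fun y => c * u y) x = c * truncConv a b φ u x := by
  unfold truncConv
  rw [← intervalIntegral.integral_const_mul]
  congr 1
  ext y
  ring

theorem truncConv_congr (hab : a ≤ b) (h : ∀ y ∈ Icc a b, u y = v y) (x : ℝ) :
    truncConv a b φ u x = truncConv a b φ v x := by
  apply intervalIntegral.integral_congr
  intro y hy
  rw [uIcc_of_le hab] at hy
  simp only [h y hy]

theorem truncConv_mono (hab : a ≤ b) (hφ : Continuous φ) (h0 : ∀ y, 0 ≤ φ y)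
    (hu : ContinuousOn u (Icc a b)) (hv : ContinuousOn v (Icc a b))
    (h : ∀ y ∈ Icc a b, u y ≤ v y) (x : ℝ) :
    truncConv a b φ u x ≤ truncConv a b φ v x :=
  intervalIntegral.integral_mono_on hab (truncConv_intervalIntegrable hab hφ hu x)
    (truncConv_intervalIntegrable hab hφ hv x)
    fun y hy => mul_le_mul_of_nonneg_left (h y hy) (h0 _)

theorem truncConv_one_mem (hab : a ≤ b) (h0 : ∀ y, 0 ≤ φ y)
    (h1 : (∫ y, φ y) = 1) (x : ℝ) : truncConv a b φ (fun _ => 1) x ∈ Icc (0 : ℝ) 1 := by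
  have hi : Integrable φ := by
    by_contra h
    rw [integral_undef h] at h1
    exact zero_ne_one h1
  have e : truncConv a b φ (fun _ => 1) x = ∫ y in (x - b)..(x - a), φ y := by
    simp only [truncConv, mul_one]
    exact intervalIntegral.integral_comp_sub_left φ x
  rw [e, intervalIntegral.integral_of_le (by linarith)]
  refine ⟨integral_nonneg h0, ?_⟩
  rw [← h1]
  exact setIntegral_le_integral hi (Filter.Eventually.of_forall h0)

theorem truncConv_const_mem (hab : a ≤ b) (h0 : ∀ y, 0 ≤ φ y)
    (h1 : (∫ y, φ y) = 1) {c : ℝ} (hc : 0 ≤ c) (x : ℝ) :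
    truncConv a b φ (fun _ => c) x ∈ Icc 0 c := by
  have h := truncConv_const_mul (a := a) (b := b) (φ := φ) (u := fun _ => 1) c x
  simp only [mul_one] at h
  obtain ⟨k0, k1⟩ := truncConv_one_mem hab h0 h1 x
  rw [h]
  exact ⟨mul_nonneg hc k0, mul_le_of_le_one_right hc k1⟩

theorem abs_truncConv_le (hab : a ≤ b) (hφ : Continuous φ) (h0 : ∀ y, 0 ≤ φ y)
    (h1 : (∫ y, φ y) = 1) (hu : ContinuousOn u (Icc a b)) {c : ℝ}
    (h : ∀ y ∈ Icc a b, |u y| ≤ c) (x : ℝ) : |truncConv a b φ u x| ≤ c := by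
  have hc : 0 ≤ c := (abs_nonneg _).trans (h a (left_mem_Icc.2 hab))
  have hm := truncConv_const_mem hab h0 h1 hc x
  have e := truncConv_const_mul (a := a) (b := b) (φ := φ) (u := fun _ => c) (-1) x
  refine abs_le.2 ⟨?_, ?_⟩
  · have := truncConv_mono hab hφ h0 (continuousOn_const (c := -1 * c)) hu
      (fun y hy => by linarith [(abs_le.1 (h y hy)).1]) x
    linarith [hm.2]
  · exact (truncConv_mono hab hφ h0 hu (continuousOn_const (c := c))
      (fun y hy => (abs_le.1 (h y hy)).2) x).trans hm.2

theorem continuous_truncConv (hφ : Continuous φ) (hu : Continuous u) :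
    Continuous (truncConv a b φ u) :=
  intervalIntegral.continuous_parametric_intervalIntegral_of_continuous' (by fun_prop) a b

theorem diffJumpOp_add (hab : a ≤ b) (hφ : Continuous φ)
    (hu : ContinuousOn u (Icc a b)) (hv : ContinuousOn v (Icc a b)) (x : ℝ) :
    diffJumpOp a b κ s φ (fun x => u x + v x) (fun x => u₁ x + v₁ x) (fun x => u₂ x + v₂ x) x =
      diffJumpOp a b κ s φ u u₁ u₂ x + diffJumpOp a b κ s φ v v₁ v₂ x := by
  simp only [diffJumpOp, truncConv_add hab hφ hu hv]
  ring

theorem diffJumpOp_const_mul (c x : ℝ) :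
    diffJumpOp a b κ s φ (fun x => c * u x) (fun x => c * u₁ x) (fun x => c * u₂ x) x =
      c * diffJumpOp a b κ s φ u u₁ u₂ x := by
  simp only [diffJumpOp, truncConv_const_mul]
  ring

theorem IsLocalMin.deriv_deriv_nonneg {x : ℝ} (h : IsLocalMin u x) (hc : ContinuousAt u x) :
    0 ≤ deriv (deriv u) x := by
  by_contra! hneg
  have hmax := isLocalMax_of_deriv_deriv_neg hneg h.deriv_eq_zero hc
  have he : u =ᶠ[nhds x] fun _ => u x := by
    filter_upwards [h, hmax] with y h1 h2 using le_antisymm h2 h1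
  rw [he.deriv.deriv_eq] at hneg
  simp at hneg

/-- Strict weak maximum principle. -/
theorem HasTwoDerivs.nonneg_of_diffJumpOp_pos (hab : a ≤ b) (hφ : Continuous φ)
    (h0 : ∀ y, 0 ≤ φ y) (h1 : (∫ y, φ y) = 1) (hs : 0 ≤ s) (hu : HasTwoDerivs a b u u₁ u₂)
    (ha : 0 ≤ u a) (hb : 0 ≤ u b) (hL : ∀ x ∈ Ioo a b, 0 < diffJumpOp a b κ s φ u u₁ u₂ x) :
    ∀ x ∈ Icc a b, 0 ≤ u x := by
  obtain ⟨z, hz, hmin⟩ := isCompact_Icc.exists_isMinOn (nonempty_Icc.2 hab) hu.cont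
  suffices h : 0 ≤ u z from fun x hx => h.trans (hmin hx)
  by_contra! hneg
  have hzo : z ∈ Ioo a b := by
    refine ⟨lt_of_le_of_ne hz.1 ?_, lt_of_le_of_ne hz.2 ?_⟩ <;> rintro rfl <;> linarith
  have hloc : IsLocalMin u z := hmin.isLocalMin (Icc_mem_nhds hzo.1 hzo.2)
  have hd1 : u₁ z = 0 := hloc.hasDerivAt_eq_zero (hu.fst z hzo)
  have he : deriv u =ᶠ[nhds z] u₁ := by
    filter_upwards [Ioo_mem_nhds hzo.1 hzo.2] with y hy using (hu.fst y hy).deriv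
  have hd2 : 0 ≤ u₂ z := by
    have := hloc.deriv_deriv_nonneg (hu.fst z hzo).continuousAt
    rwa [he.deriv_eq, (hu.snd z hzo).deriv] at this
  have hK : u z ≤ truncConv a b φ u z := by
    have e := truncConv_const_mul (a := a) (b := b) (φ := φ) (u := fun _ => 1) (u z) z
    have m := truncConv_mono hab hφ h0 (continuousOn_const (c := u z * 1)) hu.cont
      (fun y hy => by simpa using hmin hy) z
    nlinarith [(truncConv_one_mem hab h0 h1 z).2]
  have := hL z hzo
  rw [diffJumpOp, hd1] at this
  nlinarith [mul_nonneg hs (sub_nonneg.2 hK)]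

/-- The operator applied to the barrier `e^{kb} − e^{kx}`. -/
theorem exp_le_diffJumpOp_barrier (hab : a ≤ b) (hφ : Continuous φ)
    (h0 : ∀ y, 0 ≤ φ y) (h1 : (∫ y, φ y) = 1) (hs : 0 ≤ s) {k : ℝ} (hk : 0 ≤ k)
    (hkq : ∀ x ∈ Icc a b, s + 1 ≤ k ^ 2 - 2 * κ * x * k) :
    ∀ x ∈ Icc a b, Real.exp (k * a) ≤ diffJumpOp a b κ s φ
      (fun x => Real.exp (k * b) + (-1) * Real.exp (k * x))
      (fun x => -k * Real.exp (k * x)) (fun x => -k ^ 2 * Real.exp (k * x)) x := by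
  intro x hx
  have hc : ContinuousOn (fun x => Real.exp (k * x)) (Icc a b) := by fun_prop
  have hc' : ContinuousOn (fun x => (-1) * Real.exp (k * x)) (Icc a b) := by fun_prop
  rw [diffJumpOp, truncConv_add hab hφ continuousOn_const hc', truncConv_const_mul]
  have hA := (truncConv_const_mem hab h0 h1 (Real.exp_pos (k * b)).le x).2
  have hB : 0 ≤ truncConv a b φ (fun x => Real.exp (k * x)) x :=
    intervalIntegral.integral_nonneg hab fun y _ => mul_nonneg (h0 _) (Real.exp_pos _).le
  have hC : Real.exp (k * a) ≤ Real.exp (k * x) :=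
    Real.exp_le_exp.2 (mul_le_mul_of_nonneg_left hx.1 hk)
  have hD := mul_le_mul_of_nonneg_right (hkq x hx) (Real.exp_pos (k * x)).le
  nlinarith [mul_nonneg hs hB, mul_nonneg hs (sub_nonneg.2 hA)]

theorem abs_le_abs_add_abs_of_mem_Icc {x : ℝ} (hx : x ∈ Icc a b) : |x| ≤ |a| + |b| :=
  abs_le.2 ⟨by linarith [hx.1, neg_abs_le a, abs_nonneg b],
    by linarith [hx.2, le_abs_self b, abs_nonneg a]⟩

/-- A priori sup-norm bound, uniform in the density `φ` and in `0 ≤ s ≤ q`. -/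
theorem exists_sup_bound (hab : a ≤ b) (κ q : ℝ) (hq : 0 ≤ q) :
    ∃ C : ℝ, 0 ≤ C ∧ ∀ φ : ℝ → ℝ, Continuous φ → (∀ y, 0 ≤ φ y) → (∫ y, φ y) = 1 →
      ∀ s ∈ Icc 0 q, ∀ u u₁ u₂ : ℝ → ℝ, HasTwoDerivs a b u u₁ u₂ → u a = 0 → u b = 0 →
      ∀ M : ℝ, (∀ x ∈ Ioo a b, |diffJumpOp a b κ s φ u u₁ u₂ x| ≤ M) → 0 ≤ M →
      ∀ x ∈ Icc a b, |u x| ≤ C * M := by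
  set P := 2 * |κ| * (|a| + |b|) with hP
  have hP0 : 0 ≤ P := by positivity
  set k := P + q + 1 with hkdef
  have hk : 0 ≤ k := by positivity
  set C := Real.exp (k * b) / Real.exp (k * a) with hC
  have hC0 : 0 < C := by positivity
  refine ⟨C, hC0.le, ?_⟩
  intro φ hφ h0 h1 s hs u u₁ u₂ hu ha hb M hM hM0 x hx
  have hkq : ∀ x ∈ Icc a b, s + 1 ≤ k ^ 2 - 2 * κ * x * k := by
    intro x hx
    have hxP : 2 * κ * x ≤ P := by
      have hxa : |x| ≤ |a| + |b| := abs_le_abs_add_abs_of_mem_Icc hx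
      calc 2 * κ * x = 2 * (κ * x) := by ring
        _ ≤ 2 * (|κ| * |x|) := by rw [← abs_mul]; linarith [le_abs_self (κ * x)]
        _ ≤ 2 * (|κ| * (|a| + |b|)) := by gcongr
        _ = P := by ring
    nlinarith [hs.2, mul_le_mul_of_nonneg_right hxP hk, mul_nonneg hP0 hq]
  have hη : HasTwoDerivs a b (fun x => Real.exp (k * b) + (-1) * Real.exp (k * x))
      (fun x => -k * Real.exp (k * x)) (fun x => -k ^ 2 * Real.exp (k * x)) := by
    have he : ∀ x, HasDerivAt (fun x => Real.exp (k * x)) (k * Real.exp (k * x)) x := fun x => by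
      simpa [mul_comm] using ((hasDerivAt_id x).const_mul k).exp
    refine ⟨by fun_prop, fun x _ => ?_, fun x _ => ?_⟩
    · exact (((he x).const_mul (-1)).const_add _).congr_deriv (by ring)
    · exact ((he x).const_mul (-k)).congr_deriv (by ring)
  have hηL := exp_le_diffJumpOp_barrier (κ := κ) hab hφ h0 h1 hs.1 hk hkq
  have hη0 : ∀ x ∈ Icc a b, 0 ≤ Real.exp (k * b) + (-1) * Real.exp (k * x) := fun x hx => by
    have := Real.exp_le_exp.2 (mul_le_mul_of_nonneg_left hx.2 hk)
    linarith
  have key : ∀ ε > 0, ∀ c : ℝ, |c| = 1 → c * u x ≤ C * M + C * ε := by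
    intro ε hε c hc
    have hw := (hη.const_mul ((M + ε) / Real.exp (k * a))).add (hu.const_mul (-c))
    have hpos := hw.nonneg_of_diffJumpOp_pos (κ := κ) (s := s) hab hφ h0 h1 hs.1 ?_ ?_ ?_ x hx
    · have hle : (M + ε) / Real.exp (k * a) * (Real.exp (k * b) + (-1) * Real.exp (k * x)) ≤
          (M + ε) / Real.exp (k * a) * Real.exp (k * b) := by
        gcongr
        linarith [Real.exp_pos (k * x)]
      have : (M + ε) / Real.exp (k * a) * Real.exp (k * b) = C * M + C * ε := by
        rw [hC]; ring
      linarith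
    · have := hη0 a (left_mem_Icc.2 hab)
      simp only [ha, mul_zero, add_zero]
      positivity
    · have := hη0 b (right_mem_Icc.2 hab)
      simp only [hb, mul_zero, add_zero]
      positivity
    · intro y hy
      rw [diffJumpOp_add hab hφ (hη.const_mul _).cont (hu.const_mul _).cont,
        diffJumpOp_const_mul, diffJumpOp_const_mul]
      have e1 : M + ε ≤ (M + ε) / Real.exp (k * a) * diffJumpOp a b κ s φ
          (fun x => Real.exp (k * b) + (-1) * Real.exp (k * x))
          (fun x => -k * Real.exp (k * x)) (fun x => -k ^ 2 * Real.exp (k * x)) y := by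
        calc M + ε = (M + ε) / Real.exp (k * a) * Real.exp (k * a) := by field_simp
          _ ≤ _ := by
            gcongr
            exact hηL y (Ioo_subset_Icc_self hy)
      have e2 : c * diffJumpOp a b κ s φ u u₁ u₂ y ≤ M := by
        refine (le_abs_self _).trans ?_
        rw [abs_mul, hc, one_mul]
        exact hM y hy
      linarith
  refine abs_le'.2 ⟨?_, ?_⟩ <;> refine le_of_forall_pos_le_add fun ε hε => ?_
  · have := key (ε / C) (by positivity) 1 (by simp)
    rwa [one_mul, mul_div_cancel₀ _ hC0.ne'] at this
  · have := key (ε / C) (by positivity) (-1) (by simp)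
    rwa [neg_one_mul, mul_div_cancel₀ _ hC0.ne'] at this

/-- Solution of the Dirichlet problem `−u'' + 2κxu' = g`, with bounds on `u` and `u'`. -/
theorem exists_dirichlet_solution (hab : a < b) (hκ : 0 ≤ κ) :
    ∃ A : ℝ, 0 ≤ A ∧ ∀ g : ℝ → ℝ, Continuous g → ∃ u u₁ : ℝ → ℝ,
      (∀ x, HasDerivAt u (u₁ x) x) ∧ (∀ x, HasDerivAt u₁ (2 * κ * x * u₁ x - g x) x) ∧
      u a = 0 ∧ u b = 0 ∧ (∀ x ∈ Icc a b, |u x| ≤ A * ∫ y in a..b, |g y|) ∧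
      ∀ x ∈ Icc a b, |u₁ x| ≤ A * ∫ y in a..b, |g y| := by
  set R := Real.exp (κ * (|a| + |b|) ^ 2) with hR
  refine ⟨2 * R * (1 + (b - a)), by have := sub_pos.2 hab; positivity, fun g hg => ?_⟩
  set ρ : ℝ → ℝ := fun x => Real.exp (κ * x ^ 2) with hρ
  have hρc : Continuous ρ := by fun_prop
  have hρ0 : ∀ x, 0 < ρ x := fun x => Real.exp_pos _
  have hρ1 : ∀ x, 1 ≤ ρ x := fun x => Real.one_le_exp (by positivity)
  have hρR : ∀ x ∈ Icc a b, ρ x ≤ R := fun x hx => by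
    refine Real.exp_le_exp.2 (mul_le_mul_of_nonneg_left (sq_le_sq.2 ?_) hκ)
    rw [abs_of_nonneg (by positivity : 0 ≤ |a| + |b|)]
    exact abs_le_abs_add_abs_of_mem_Icc hx
  have hρd : ∀ x, HasDerivAt ρ (2 * κ * x * ρ x) x := fun x =>
    (((hasDerivAt_pow 2 x).const_mul κ).exp).congr_deriv (by simp only [hρ]; push_cast; ring)
  set N := ∫ y in a..b, |g y| with hN
  have hN0 : 0 ≤ N := intervalIntegral.integral_nonneg hab.le fun _ _ => abs_nonneg _
  have hgc : Continuous fun y => g y / ρ y := hg.div hρc fun x => (hρ0 x).ne'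
  set H : ℝ → ℝ := fun x => ∫ y in a..x, g y / ρ y with hH
  have hHd : ∀ x, HasDerivAt H (g x / ρ x) x := fun x =>
    (hgc.integral_hasStrictDerivAt a x).hasDerivAt
  have hHc : Continuous H := continuous_iff_continuousAt.2 fun x => (hHd x).continuousAt
  have hHN : ∀ x ∈ Icc a b, |H x| ≤ N := fun x hx => by
    calc |H x| ≤ ∫ y in a..x, |g y / ρ y| := intervalIntegral.abs_integral_le_integral_abs hx.1
      _ ≤ ∫ y in a..x, |g y| := by
        refine intervalIntegral.integral_mono_on hx.1 (hgc.abs.intervalIntegrable _ _)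
          (hg.abs.intervalIntegrable _ _) fun y _ => ?_
        rw [abs_div, abs_of_pos (hρ0 y)]
        exact div_le_self (abs_nonneg _) (hρ1 y)
      _ ≤ N := by
        refine intervalIntegral.integral_mono_interval le_rfl hx.1 hx.2
          (Filter.Eventually.of_forall fun y => abs_nonneg _) (hg.abs.intervalIntegrable _ _)
  have hS : 0 < ∫ y in a..b, ρ y :=
    intervalIntegral.intervalIntegral_pos_of_pos (hρc.intervalIntegrable _ _) hρ0 hab
  set c := (∫ y in a..b, ρ y * H y) / ∫ y in a..b, ρ y with hc
  have hcN : |c| ≤ N := by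
    rw [hc, abs_div, abs_of_pos hS, div_le_iff₀ hS, ← intervalIntegral.integral_const_mul]
    refine (intervalIntegral.abs_integral_le_integral_abs hab.le).trans ?_
    refine intervalIntegral.integral_mono_on hab.le ((hρc.mul hHc).abs.intervalIntegrable _ _)
      ((continuous_const.mul hρc).intervalIntegrable _ _) fun y hy => ?_
    rw [abs_mul, abs_of_pos (hρ0 y), mul_comm]
    exact mul_le_mul_of_nonneg_right (hHN y hy) (hρ0 y).le
  set u₁ : ℝ → ℝ := fun x => ρ x * (c - H x) with hu₁
  have hu₁c : Continuous u₁ := by fun_prop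
  have hu₁N : ∀ x ∈ Icc a b, |u₁ x| ≤ 2 * R * N := fun x hx => by
    calc |u₁ x| = ρ x * |c - H x| := by rw [hu₁, abs_mul, abs_of_pos (hρ0 x)]
      _ ≤ R * (N + N) := by
        gcongr
        · exact hρR x hx
        · exact (abs_sub _ _).trans (add_le_add hcN (hHN x hx))
      _ = 2 * R * N := by ring
  refine ⟨fun x => ∫ y in a..x, u₁ y, u₁, fun x => ?_, fun x => ?_, by simp, ?_, fun x hx => ?_,
    fun x hx => ?_⟩
  · exact (hu₁c.integral_hasStrictDerivAt a x).hasDerivAt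
  · refine ((hρd x).mul ((hHd x).const_sub c)).congr_deriv ?_
    have := (hρ0 x).ne'
    simp only [hu₁]
    field_simp
    ring
  · have hi₁ : IntervalIntegrable (fun y => ρ y * c) volume a b :=
      (hρc.mul continuous_const).intervalIntegrable _ _
    have hi₂ : IntervalIntegrable (fun y => ρ y * H y) volume a b :=
      (hρc.mul hHc).intervalIntegrable _ _
    simp only [hu₁, mul_sub]
    rw [intervalIntegral.integral_sub hi₁ hi₂, intervalIntegral.integral_mul_const, hc]
    field_simp
    ring
  · have h := intervalIntegral.norm_integral_le_of_norm_le_const (a := a) (b := x) (f := u₁)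
      (C := 2 * R * N) fun y hy => by
        rw [uIoc_of_le hx.1] at hy
        exact hu₁N y ⟨hy.1.le, hy.2.trans hx.2⟩
    rw [Real.norm_eq_abs, abs_of_nonneg (sub_nonneg.2 hx.1)] at h
    refine h.trans ?_
    have : 2 * R * N * (x - a) ≤ 2 * R * N * (b - a) := by
      gcongr
      exact hx.2
    nlinarith [show 0 ≤ 2 * R * N by positivity]
  · have := sub_pos.2 hab
    nlinarith [hu₁N x hx, show 0 ≤ 2 * R * N * (b - a) by positivity]

/-- Method of continuity along `1 − tT`, `t ∈ [0,1]`. -/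
theorem isUnit_one_sub_of_bounded_below {E : Type*} [NormedAddCommGroup E] [NormedSpace ℝ E]
    [CompleteSpace E] (T : E →L[ℝ] E) (M : ℝ)
    (hM : ∀ t ∈ Icc (0 : ℝ) 1, ∀ v, ‖v‖ ≤ M * ‖v - t • T v‖) : IsUnit (1 - T) := by
  have hstep : ∃ n : ℕ, 0 < n ∧ ‖T‖ * |M| < n := by
    obtain ⟨n, hn⟩ := exists_nat_gt (‖T‖ * |M|)
    exact ⟨n, by exact_mod_cast (show (0 : ℝ) ≤ ‖T‖ * |M| by positivity).trans_lt hn, hn⟩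
  obtain ⟨n, hn0, hn⟩ := hstep
  have hn0' : (0 : ℝ) < n := by exact_mod_cast hn0
  have key : ∀ m : ℕ, m ≤ n → IsUnit (1 - ((m : ℝ) / n) • T) := by
    intro m
    induction m with
    | zero => simp
    | succ m ih =>
      intro hm
      obtain ⟨U, hU⟩ := ih (by omega)
      have ht : (m : ℝ) / n ∈ Icc (0 : ℝ) 1 :=
        ⟨by positivity, (div_le_one hn0').2 (by exact_mod_cast (by omega : m ≤ n))⟩
      have hinv : ‖(↑U⁻¹ : E →L[ℝ] E)‖ ≤ |M| := by
        refine ContinuousLinearMap.opNorm_le_bound _ (abs_nonneg _) fun v => ?_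
        have h := hM _ ht ((↑U⁻¹ : E →L[ℝ] E) v)
        have e : (↑U⁻¹ : E →L[ℝ] E) v - ((m : ℝ) / n) • T ((↑U⁻¹ : E →L[ℝ] E) v) = v := by
          have : ((↑U : E →L[ℝ] E) * ↑U⁻¹) v = v := by rw [Units.mul_inv]; rfl
          rw [hU] at this
          simpa using this
        rw [e] at h
        exact h.trans (mul_le_mul_of_nonneg_right (le_abs_self M) (norm_nonneg _))
      have hsmall : ‖(↑U⁻¹ : E →L[ℝ] E) * ((1 / (n : ℝ)) • T)‖ < 1 := by
        calc _ ≤ ‖(↑U⁻¹ : E →L[ℝ] E)‖ * ‖(1 / (n : ℝ)) • T‖ := norm_mul_le _ _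
          _ ≤ |M| * (1 / n * ‖T‖) := by
            rw [norm_smul, Real.norm_of_nonneg (by positivity)]
            gcongr
          _ = (‖T‖ * |M|) / n := by ring
          _ < 1 := (div_lt_one hn0').2 hn
      have h := U.isUnit.mul (isUnit_one_sub_of_norm_lt_one hsmall)
      rw [mul_sub, mul_one, ← mul_assoc, Units.mul_inv, one_mul, hU] at h
      convert h using 1
      rw [sub_sub, ← add_smul]
      congr 2
      push_cast
      ring
  have := key n le_rfl
  rwa [div_self hn0'.ne', one_smul] at this

theorem HasTwoDerivs.of_forall (hu : ∀ x, HasDerivAt u (u₁ x) x)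
    (hu₁ : ∀ x, HasDerivAt u₁ (u₂ x) x) : HasTwoDerivs a b u u₁ u₂ :=
  ⟨fun x _ => (hu x).continuousAt.continuousWithinAt, fun x _ => hu x, fun x _ => hu₁ x⟩

theorem HasTwoDerivs.eq_zero (hab : a ≤ b) (hq : 0 ≤ q) (hφ : Continuous φ)
    (h0 : ∀ y, 0 ≤ φ y) (h1 : (∫ y, φ y) = 1) (hu : HasTwoDerivs a b u u₁ u₂) (ha : u a = 0)
    (hb : u b = 0) (hL : ∀ x ∈ Ioo a b, diffJumpOp a b κ q φ u u₁ u₂ x = 0) :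
    ∀ x ∈ Icc a b, u x = 0 := by
  obtain ⟨C, -, hC⟩ := exists_sup_bound hab κ q hq
  intro x hx
  have := hC φ hφ h0 h1 q ⟨hq, le_rfl⟩ u u₁ u₂ hu ha hb 0
    (fun y hy => by rw [hL y hy, abs_zero]) le_rfl x hx
  rwa [mul_zero, abs_nonpos_iff] at this

theorem abs_sub_truncConv_le (hab : a ≤ b) (hφ : Continuous φ) (h0 : ∀ y, 0 ≤ φ y)
    (h1 : (∫ y, φ y) = 1) (hq : 0 ≤ q) (hu : ContinuousOn u (Icc a b)) {c : ℝ}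
    (h : ∀ y ∈ Icc a b, |u y| ≤ c) {x : ℝ} (hx : x ∈ Icc a b) :
    |q * (u x - truncConv a b φ u x)| ≤ 2 * q * c := by
  rw [abs_mul, abs_of_nonneg hq]
  have := abs_truncConv_le hab hφ h0 h1 hu h x
  have := (abs_sub (u x) (truncConv a b φ u x)).trans (add_le_add (h x hx) this)
  nlinarith

/-- The operator on `C([a,b])` sending `v` to the solution of the Dirichlet problem
`−u'' + 2κxu' = −q(v − φ ⋆ v)`. -/
theorem exists_jump_solution_operator (hab : a < b) (hκ : 0 ≤ κ) (hq : 0 ≤ q)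
    (hφ : Continuous φ) (h0 : ∀ y, 0 ≤ φ y) (h1 : (∫ y, φ y) = 1) :
    ∃ T : C(Icc a b, ℝ) →L[ℝ] C(Icc a b, ℝ), ∀ v : C(Icc a b, ℝ), ∃ u u₁ : ℝ → ℝ,
      (∀ x, HasDerivAt u (u₁ x) x) ∧
      (∀ x, HasDerivAt u₁ (2 * κ * x * u₁ x +
        q * (IccExtend hab.le v x - truncConv a b φ (IccExtend hab.le v) x)) x) ∧
      u a = 0 ∧ u b = 0 ∧ ∀ x : Icc a b, T v x = u x := by
  obtain ⟨A, hA, hsol⟩ := exists_dirichlet_solution hab hκ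
  have hext : ∀ v : C(Icc a b, ℝ), Continuous (IccExtend hab.le v) :=
    fun v => v.continuous.Icc_extend'
  set G : C(Icc a b, ℝ) → ℝ → ℝ := fun v x =>
    -(q * (IccExtend hab.le v x - truncConv a b φ (IccExtend hab.le v) x)) with hG
  have hGc : ∀ v, Continuous (G v) := fun v =>
    (continuous_const.mul ((hext v).sub (continuous_truncConv hφ (hext v)))).neg
  choose U U₁ hU hU₁ hUa hUb hUN _ using fun v => hsol (G v) (hGc v)
  have hD : ∀ v, HasTwoDerivs a b (U v) (U₁ v) (fun x => 2 * κ * x * U₁ v x - G v x) :=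
    fun v => HasTwoDerivs.of_forall (hU v) (hU₁ v)
  have hGadd : ∀ v w x, G (v + w) x = G v x + G w x := fun v w x => by
    have e : IccExtend hab.le (v + w : C(Icc a b, ℝ)) =
      fun y => IccExtend hab.le v y + IccExtend hab.le w y := rfl
    simp only [hG, e, truncConv_add hab.le hφ (hext v).continuousOn (hext w).continuousOn]
    ring
  have hGsmul : ∀ (c : ℝ) v x, G (c • v) x = c * G v x := fun c v x => by
    have e : IccExtend hab.le (c • v : C(Icc a b, ℝ)) = fun y => c * IccExtend hab.le v y := rfl
    simp only [hG, e, truncConv_const_mul]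
    ring
  have hadd : ∀ v w, ∀ x ∈ Icc a b, U (v + w) x = U v x + U w x := fun v w x hx => by
    have := ((hD (v + w)).add (((hD v).add (hD w)).const_mul (-1))).eq_zero (κ := κ) hab.le
      le_rfl hφ h0 h1 (by simp [hUa]) (by simp [hUb])
      (fun y hy => by simp only [diffJumpOp, hGadd]; ring) x hx
    linarith
  have hsmul : ∀ (c : ℝ) v, ∀ x ∈ Icc a b, U (c • v) x = c * U v x := fun c v x hx => by
    have := ((hD (c • v)).add ((hD v).const_mul (-c))).eq_zero (κ := κ) hab.le
      le_rfl hφ h0 h1 (by simp [hUa]) (by simp [hUb])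
      (fun y hy => by simp only [diffJumpOp, hGsmul]; ring) x hx
    linarith
  have hUc : ∀ v, Continuous (U v) := fun v =>
    continuous_iff_continuousAt.2 fun x => (hU v x).continuousAt
  let T₀ : C(Icc a b, ℝ) →ₗ[ℝ] C(Icc a b, ℝ) :=
    { toFun := fun v => ⟨fun x => U v x, (hUc v).comp continuous_subtype_val⟩
      map_add' := fun v w => ContinuousMap.ext fun x => hadd v w x x.2
      map_smul' := fun c v => ContinuousMap.ext fun x => hsmul c v x x.2 }
  refine ⟨T₀.mkContinuous (A * (2 * q * (b - a))) fun v => ?_, fun v =>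
    ⟨U v, U₁ v, hU v, fun x => (hU₁ v x).congr_deriv (by simp only [hG]; ring), hUa v, hUb v,
      fun x => rfl⟩⟩
  have hba := sub_pos.2 hab
  refine (ContinuousMap.norm_le _ (by positivity)).2 fun x => (hUN v x x.2).trans ?_
  have hint : ∫ y in a..b, |G v y| ≤ ∫ _ in a..b, 2 * q * ‖v‖ := by
    refine intervalIntegral.integral_mono_on hab.le ((hGc v).abs.intervalIntegrable _ _)
      intervalIntegrable_const fun y hy => ?_
    simp only [hG, abs_neg]
    exact abs_sub_truncConv_le hab.le hφ h0 h1 hq (hext v).continuousOn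
      (fun z _ => v.norm_coe_le_norm _) hy
  rw [intervalIntegral.integral_const, smul_eq_mul] at hint
  calc _ ≤ A * ((b - a) * (2 * q * ‖v‖)) := by gcongr
    _ = _ := by ring

/-- Existence for the normalized problem. -/
theorem exists_diffJump_solution (hab : a < b) (hκ : 0 ≤ κ) (hq : 0 ≤ q)
    (hφ : Continuous φ) (h0 : ∀ y, 0 ≤ φ y) (h1 : (∫ y, φ y) = 1) (hg : Continuous g) :
    ∃ u u₁ u₂ : ℝ → ℝ, (∀ x, HasDerivAt u (u₁ x) x) ∧ (∀ x, HasDerivAt u₁ (u₂ x) x) ∧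
      Continuous u₂ ∧ u a = 0 ∧ u b = 0 ∧
      ∀ x ∈ Icc a b, diffJumpOp a b κ q φ u u₁ u₂ x = g x := by
  obtain ⟨A, hA, hsol⟩ := exists_dirichlet_solution hab hκ
  obtain ⟨C, hC0, hC⟩ := exists_sup_bound hab.le κ q hq
  obtain ⟨T, hT⟩ := exists_jump_solution_operator hab hκ hq hφ h0 h1
  have hext : ∀ v : C(Icc a b, ℝ), Continuous (IccExtend hab.le v) :=
    fun v => v.continuous.Icc_extend'
  have hunit : IsUnit (1 - T) := by
    refine isUnit_one_sub_of_bounded_below T (1 + C * (2 * q)) fun t ht v => ?_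
    obtain ⟨u, u₁, hu, hu₁, hua, hub, hTu⟩ := hT v
    set r := v - t • T v with hr
    have hD := (HasTwoDerivs.of_forall (a := a) (b := b) hu hu₁).const_mul t
    have hv : ∀ y ∈ Icc a b, IccExtend hab.le v y = IccExtend hab.le r y + t * u y := by
      intro y hy
      rw [IccExtend_of_mem _ _ hy, IccExtend_of_mem _ _ hy, hr]
      simp [hTu]
    have hw := hC φ hφ h0 h1 (t * q) ⟨mul_nonneg ht.1 hq, mul_le_of_le_one_left hq ht.2⟩ _ _ _ hD
      (by simp [hua]) (by simp [hub]) (2 * q * ‖r‖) (fun x hx => ?_) (by positivity)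
    · refine (ContinuousMap.norm_le _ (by positivity)).2 fun x => ?_
      have e := hv x x.2
      rw [IccExtend_val, IccExtend_val] at e
      rw [e, Real.norm_eq_abs]
      refine (abs_add_le _ _).trans ((add_le_add (r.norm_coe_le_norm x) (hw x x.2)).trans_eq ?_)
      ring
    · have e : diffJumpOp a b κ (t * q) φ (fun x => t * u x) (fun x => t * u₁ x) (fun x =>
          t * (2 * κ * x * u₁ x + q * (IccExtend hab.le v x -
            truncConv a b φ (IccExtend hab.le v) x))) x =
          t * -(q * (IccExtend hab.le r x - truncConv a b φ (IccExtend hab.le r) x)) := by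
        rw [diffJumpOp, truncConv_congr hab.le hv, truncConv_add hab.le hφ (hext r).continuousOn
          hD.cont, hv x (Ioo_subset_Icc_self hx)]
        ring
      rw [e, abs_mul, abs_of_nonneg ht.1, abs_neg]
      exact (mul_le_of_le_one_left (abs_nonneg _) ht.2).trans
        (abs_sub_truncConv_le hab.le hφ h0 h1 hq (hext r).continuousOn
          (fun z _ => r.norm_coe_le_norm _) (Ioo_subset_Icc_self hx))
  obtain ⟨p, p₁, hp, hp₁, hpa, hpb, -, -⟩ := hsol g hg
  have hpc : Continuous p := continuous_iff_continuousAt.2 fun x => (hp x).continuousAt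
  obtain ⟨S, hS⟩ := hunit
  set p₀ : C(Icc a b, ℝ) := ⟨fun x => p x, hpc.comp continuous_subtype_val⟩ with hp₀
  set v := (↑S⁻¹ : C(Icc a b, ℝ) →L[ℝ] C(Icc a b, ℝ)) p₀ with hvdef
  have hv : v - T v = p₀ := by
    have : ((↑S : C(Icc a b, ℝ) →L[ℝ] C(Icc a b, ℝ)) * ↑S⁻¹) p₀ = p₀ := by
      rw [Units.mul_inv]; rfl
    rw [hS] at this
    simpa using this
  obtain ⟨u, u₁, hu, hu₁, hua, hub, hTu⟩ := hT v
  have hvu : ∀ y ∈ Icc a b, IccExtend hab.le v y = p y + u y := fun y hy => by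
    have := congrArg (fun w : C(Icc a b, ℝ) => w ⟨y, hy⟩) hv
    simp only [ContinuousMap.sub_apply, hTu, hp₀, ContinuousMap.coe_mk] at this
    rw [IccExtend_of_mem _ _ hy]
    linarith
  have hp₁c : Continuous p₁ := continuous_iff_continuousAt.2 fun x => (hp₁ x).continuousAt
  have hu₁c : Continuous u₁ := continuous_iff_continuousAt.2 fun x => (hu₁ x).continuousAt
  have hKc := continuous_truncConv (a := a) (b := b) hφ (hext v)
  have hvc := hext v
  refine ⟨_, _, _, fun x => (hp x).add (hu x), fun x => (hp₁ x).add (hu₁ x), by fun_prop,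
    by simp [hpa, hua], by simp [hpb, hub], fun x hx => ?_⟩
  rw [diffJumpOp, truncConv_congr hab.le hvu, hvu x hx]
  simp only [Pi.add_apply]
  have : (p + u : ℝ → ℝ) = fun y => p y + u y := rfl
  rw [this]
  ring

/-- Pointwise a priori bound on the second derivative, uniform in the density `φ`. -/
theorem exists_second_deriv_bound (hab : a < b) (hκ : 0 ≤ κ) (hq : 0 ≤ q) :
    ∃ E : ℝ, 0 ≤ E ∧ ∀ φ : ℝ → ℝ, Continuous φ → (∀ y, 0 ≤ φ y) → (∫ y, φ y) = 1 →
      ∀ g : ℝ → ℝ, Continuous g → ∀ u u₁ u₂ : ℝ → ℝ, HasTwoDerivs a b u u₁ u₂ →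
      u a = 0 → u b = 0 → (∀ x ∈ Ioo a b, diffJumpOp a b κ q φ u u₁ u₂ x = g x) →
      ∀ x ∈ Ioo a b, |u₂ x| ≤ E * (∫ y in a..b, |g y|) + |g x| := by
  obtain ⟨A, hA, hsol⟩ := exists_dirichlet_solution hab hκ
  obtain ⟨C, hC0, hC⟩ := exists_sup_bound hab.le κ q hq
  have hba := sub_pos.2 hab
  set D := A + C * (2 * q * A) with hD
  have hD0 : 0 ≤ D := by positivity
  refine ⟨2 * κ * (|a| + |b|) * (A * (1 + 2 * q * D * (b - a))) + 2 * q * D, by positivity, ?_⟩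
  intro φ hφ h0 h1 g hg u u₁ u₂ hu ha hb hL
  set N := ∫ y in a..b, |g y| with hN
  have hN0 : 0 ≤ N := intervalIntegral.integral_nonneg hab.le fun _ _ => abs_nonneg _
  have hsup : ∀ x ∈ Icc a b, |u x| ≤ D * N := by
    obtain ⟨p, p₁, hp, hp₁, hpa, hpb, hpN, -⟩ := hsol g hg
    have hP := HasTwoDerivs.of_forall (a := a) (b := b) hp hp₁
    intro x hx
    have hw := hC φ hφ h0 h1 q ⟨hq, le_rfl⟩ _ _ _ (hu.add (hP.const_mul (-1)))
      (by simp [ha, hpa]) (by simp [hb, hpb]) (2 * q * (A * N)) (fun y hy => ?_)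
      (by positivity) x hx
    · have h := abs_add_le (u x + -1 * p x) (p x)
      rw [show u x + -1 * p x + p x = u x by ring] at h
      calc |u x| ≤ C * (2 * q * (A * N)) + A * N := h.trans (add_le_add hw (hpN x hx))
        _ = D * N := by rw [hD]; ring
    · rw [diffJumpOp_add hab.le hφ hu.cont (hP.const_mul (-1)).cont, diffJumpOp_const_mul, hL y hy]
      have := abs_sub_truncConv_le hab.le hφ h0 h1 hq hP.cont hpN (Ioo_subset_Icc_self hy)
      rw [← abs_neg] at this
      convert this using 2
      simp only [diffJumpOp]
      ring
  set e := IccExtend hab.le (fun x : Icc a b => u x) with he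
  have hec : Continuous e := (continuousOn_iff_continuous_domRestrict.1 hu.cont).Icc_extend'
  have heu : ∀ x ∈ Icc a b, e x = u x := fun x hx => IccExtend_of_mem _ _ hx
  set G : ℝ → ℝ := fun x => g x - q * (e x - truncConv a b φ e x) with hG
  have hGc : Continuous G :=
    hg.sub (continuous_const.mul (hec.sub (continuous_truncConv hφ hec)))
  have hGN : ∫ y in a..b, |G y| ≤ (1 + 2 * q * D * (b - a)) * N := by
    have h : ∫ y in a..b, |G y| ≤ ∫ y in a..b, (|g y| + 2 * q * (D * N)) := by
      refine intervalIntegral.integral_mono_on hab.le (hGc.abs.intervalIntegrable _ _)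
        ((hg.abs.add continuous_const).intervalIntegrable _ _) fun y hy => ?_
      refine (abs_sub _ _).trans (add_le_add_right ?_ _)
      exact abs_sub_truncConv_le hab.le hφ h0 h1 hq hec.continuousOn
        (fun z hz => by rw [heu z hz]; exact hsup z hz) hy
    rw [intervalIntegral.integral_add (hg.abs.intervalIntegrable _ _) intervalIntegrable_const,
      intervalIntegral.integral_const, smul_eq_mul] at h
    refine h.trans_eq ?_
    ring
  obtain ⟨p, p₁, hp, hp₁, hpa, hpb, -, hpN⟩ := hsol G hGc
  have hP := HasTwoDerivs.of_forall (a := a) (b := b) hp hp₁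
  have hKe : ∀ x, truncConv a b φ e x = truncConv a b φ u x := truncConv_congr hab.le heu
  have hup : ∀ x ∈ Icc a b, u x = p x := fun x hx => by
    have := (hu.add (hP.const_mul (-1))).eq_zero (κ := κ) hab.le le_rfl hφ h0 h1
      (by simp [ha, hpa]) (by simp [hb, hpb]) (fun y hy => by
        have := hL y hy
        simp only [diffJumpOp, hG, hKe, heu y (Ioo_subset_Icc_self hy)] at this ⊢
        linarith) x hx
    linarith
  intro x hx
  have hxI := Ioo_subset_Icc_self hx
  have hu₁p : u₁ x = p₁ x := by
    refine (hu.fst x hx).unique ((hp x).congr_of_eventuallyEq ?_)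
    filter_upwards [Icc_mem_nhds hx.1 hx.2] with y hy using hup y hy
  have hu₁N : |u₁ x| ≤ A * ((1 + 2 * q * D * (b - a)) * N) := by
    rw [hu₁p]
    exact (hpN x hxI).trans (mul_le_mul_of_nonneg_left hGN hA)
  have hxab : |x| ≤ |a| + |b| := abs_le_abs_add_abs_of_mem_Icc hxI
  have hu₂ : u₂ x = 2 * κ * x * u₁ x + q * (u x - truncConv a b φ u x) - g x := by
    rw [← hL x hx, diffJumpOp]
    ring
  have hdrift : |2 * κ * x * u₁ x| ≤
      2 * κ * (|a| + |b|) * (A * ((1 + 2 * q * D * (b - a)) * N)) := by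
    rw [abs_mul, abs_mul, abs_of_nonneg (by positivity : 0 ≤ 2 * κ)]
    gcongr
  have hjump := abs_sub_truncConv_le hab.le hφ h0 h1 hq hu.cont hsup hxI
  rw [hu₂]
  refine (abs_sub _ _).trans (add_le_add_left ((abs_add_le _ _).trans
    ((add_le_add hdrift hjump).trans_eq ?_)) _)
  ring

theorem sq_integral_abs_le (hab : a ≤ b) (hg : Continuous g) :
    (∫ x in a..b, |g x|) ^ 2 ≤ (b - a) * ∫ x in a..b, g x ^ 2 := by
  have hi₁ : IntervalIntegrable (fun x => |g x|) volume a b := hg.abs.intervalIntegrable _ _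
  have hi₂ : IntervalIntegrable (fun x => g x ^ 2) volume a b := (hg.pow 2).intervalIntegrable _ _
  have h : ∀ t : ℝ, 0 ≤ (b - a) * (t * t) + (-2 * ∫ x in a..b, |g x|) * t +
      ∫ x in a..b, g x ^ 2 := fun t => by
    have h : 0 ≤ ∫ x in a..b, (t ^ 2 + (-2 * t) * |g x| + g x ^ 2) :=
      intervalIntegral.integral_nonneg hab fun x _ => by
        nlinarith [sq_nonneg (t - |g x|), sq_abs (g x)]
    rw [intervalIntegral.integral_add (intervalIntegrable_const.add (hi₁.const_mul _)) hi₂,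
      intervalIntegral.integral_add intervalIntegrable_const (hi₁.const_mul _),
      intervalIntegral.integral_const, intervalIntegral.integral_const_mul, smul_eq_mul] at h
    linarith
  have := discrim_le_zero h
  rw [discrim] at this
  linarith

theorem integral_sq_le_of_abs_le (hab : a ≤ b) {E : ℝ} (hg : Continuous g)
    (hu : ∀ x ∈ Ioo a b, |u x| ≤ E * (∫ y in a..b, |g y|) + |g x|) :
    ∫ x in a..b, u x ^ 2 ≤ (2 * E ^ 2 * (b - a) ^ 2 + 2) * ∫ x in a..b, g x ^ 2 := by
  set N := ∫ y in a..b, |g y| with hN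
  have hN0 : 0 ≤ N := intervalIntegral.integral_nonneg hab fun _ _ => abs_nonneg _
  have hi₂ : IntervalIntegrable (fun x => 2 * g x ^ 2) volume a b :=
    (continuous_const.mul (hg.pow 2)).intervalIntegrable _ _
  have hle : ∫ x in a..b, u x ^ 2 ≤ ∫ x in a..b, (2 * (E * N) ^ 2 + 2 * g x ^ 2) := by
    have hint := (intervalIntegrable_const (μ := volume) (a := a) (b := b)
      (c := 2 * (E * N) ^ 2)).add hi₂
    rw [intervalIntegrable_iff_integrableOn_Ioo_of_le hab] at hint
    simp only [intervalIntegral.integral_of_le hab, integral_Ioc_eq_integral_Ioo]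
    refine integral_mono_of_nonneg (Filter.Eventually.of_forall fun x => sq_nonneg _) hint ?_
    filter_upwards [ae_restrict_mem measurableSet_Ioo] with x hx
    have h := hu x hx
    have h2 : |u x| ^ 2 ≤ (E * N + |g x|) ^ 2 := pow_le_pow_left₀ (abs_nonneg _) h 2
    nlinarith [sq_abs (u x), sq_abs (g x), sq_nonneg (E * N - |g x|)]
  rw [intervalIntegral.integral_add intervalIntegrable_const hi₂,
    intervalIntegral.integral_const, intervalIntegral.integral_const_mul, smul_eq_mul] at hle
  have := mul_le_mul_of_nonneg_left (sq_integral_abs_le hab hg)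
    (by have := sub_nonneg.2 hab; positivity : 0 ≤ 2 * E ^ 2 * (b - a))
  rw [← hN] at this
  nlinarith

theorem IsClassicalSolution.hasTwoDerivs {σ μ lam : ℝ} {f : ℝ → ℝ}
    (h : IsClassicalSolution a b σ μ lam φ f v) :
    HasTwoDerivs a b v (deriv v) (deriv (deriv v)) := by
  have hc : ContDiffOn ℝ 2 v (Ioo a b) := h.2.1.mono Ioo_subset_Icc_self
  have hc' : ContDiffOn ℝ 1 (deriv v) (Ioo a b) := hc.deriv_of_isOpen isOpen_Ioo (by norm_num)
  refine ⟨h.2.1.continuousOn, fun x hx => ?_, fun x hx => ?_⟩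
  · exact ((hc.contDiffAt (isOpen_Ioo.mem_nhds hx)).differentiableAt (by norm_num)).hasDerivAt
  · exact ((hc'.contDiffAt (isOpen_Ioo.mem_nhds hx)).differentiableAt (by norm_num)).hasDerivAt

theorem IsClassicalSolution.diffJumpOp_eq {σ μ lam : ℝ} {f : ℝ → ℝ} (hσ : 0 < σ)
    (h : IsClassicalSolution a b σ μ lam φ f v) {x : ℝ} (hx : x ∈ Ioo a b) :
    diffJumpOp a b (μ / σ ^ 2) (2 * lam / σ ^ 2) φ v (deriv v) (deriv (deriv v)) x =
      2 / σ ^ 2 * f x := by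
  rw [← h.2.2 x hx, Iop, diffJumpOp, truncConv]
  field_simp
  ring

theorem isClassicalSolution_indicator (hab : a < b) {σ μ lam : ℝ} {f : ℝ → ℝ} (hσ : 0 < σ)
    (hu : ∀ x, HasDerivAt u (u₁ x) x) (hu₁ : ∀ x, HasDerivAt u₁ (u₂ x) x) (hu₂ : Continuous u₂)
    (ha : u a = 0) (hb : u b = 0)
    (hL : ∀ x ∈ Ioo a b, diffJumpOp a b (μ / σ ^ 2) (2 * lam / σ ^ 2) φ u u₁ u₂ x =
      2 / σ ^ 2 * f x) :
    IsClassicalSolution a b σ μ lam φ f ((Ioo a b).indicator u) := by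
  have hd : deriv u = u₁ := funext fun x => (hu x).deriv
  have hd₁ : deriv u₁ = u₂ := funext fun x => (hu₁ x).deriv
  have hC1 : ContDiff ℝ 1 u₁ := contDiff_one_iff_deriv.2
    ⟨fun x => (hu₁ x).differentiableAt, by rwa [hd₁]⟩
  have hC2 : ContDiff ℝ 2 u := by
    rw [show (2 : WithTop ℕ∞) = 1 + 1 by norm_num, contDiff_succ_iff_deriv]
    exact ⟨fun x => (hu x).differentiableAt, by simp, by rwa [hd]⟩
  have heq : ∀ x ∈ Icc a b, (Ioo a b).indicator u x = u x := fun x hx => by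
    by_cases hxo : x ∈ Ioo a b
    · exact indicator_of_mem hxo u
    · rw [indicator_of_notMem hxo]
      rcases eq_or_lt_of_le hx.1 with rfl | h1
      · exact ha.symm
      rcases eq_or_lt_of_le hx.2 with rfl | h2
      · exact hb.symm
      exact absurd ⟨h1, h2⟩ hxo
  refine ⟨fun x hx => indicator_of_notMem hx u, hC2.contDiffOn.congr heq, fun x hx => ?_⟩
  have he : (Ioo a b).indicator u =ᶠ[nhds x] u := by
    filter_upwards [Icc_mem_nhds hx.1 hx.2] with y hy using heq y hy
  have hK : (∫ y in a..b, φ (x - y) * (Ioo a b).indicator u y) = truncConv a b φ u x :=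
    truncConv_congr hab.le heq x
  rw [he.deriv.deriv_eq, he.deriv_eq, hd, hd₁, Iop, hK, heq x (Ioo_subset_Icc_self hx)]
  have h := hL x hx
  rw [diffJumpOp] at h
  field_simp at h
  linarith

end

/-- For every `f ∈ C¹([a,b])` the boundary value problem has exactly one classical solution,
and there is `c₃ > 0` depending only on `a, b, σ, μ, λ` such that every classical solution
satisfies `‖v''‖_{L²(a,b)} ≤ c₃‖f‖_{L²(a,b)}`. -/
theorem stmt5 (a b σ μ lam : ℝ) (hab : a < b) (hσ : 0 < σ) (hμ : 0 < μ) (hlam : 0 < lam) :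
    ∃ c₃ > (0 : ℝ), ∀ φ : ℝ → ℝ, Continuous φ → (∀ y, 0 ≤ φ y) → (∫ y, φ y) = 1 →
      ∀ f : ℝ → ℝ, ContDiffOn ℝ 1 f (Set.Icc a b) →
        (∃! v : ℝ → ℝ, IsClassicalSolution a b σ μ lam φ f v) ∧
        ∀ v : ℝ → ℝ, IsClassicalSolution a b σ μ lam φ f v →
          L2norm a b (deriv (deriv v)) ≤ c₃ * L2norm a b f := by
  have hκ : 0 ≤ μ / σ ^ 2 := by positivity
  have hq : 0 ≤ 2 * lam / σ ^ 2 := by positivity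
  have hba := sub_pos.2 hab
  obtain ⟨E, hE, hbound⟩ := exists_second_deriv_bound hab hκ hq
  refine ⟨Real.sqrt (2 * E ^ 2 * (b - a) ^ 2 + 2) * (2 / σ ^ 2), by positivity, ?_⟩
  intro φ hφ h0 h1 f hf
  set g : ℝ → ℝ := fun x => 2 / σ ^ 2 * IccExtend hab.le (fun y : Icc a b => f y) x with hg
  have hgc : Continuous g := continuous_const.mul
    (continuousOn_iff_continuous_domRestrict.1 hf.continuousOn).Icc_extend'
  have hgf : ∀ x ∈ Icc a b, g x = 2 / σ ^ 2 * f x := fun x hx => by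
    simp only [hg, IccExtend_of_mem _ _ hx]
  have hbdry : ∀ v, IsClassicalSolution a b σ μ lam φ f v → v a = 0 ∧ v b = 0 :=
    fun v hv => ⟨hv.1 a (by simp), hv.1 b (by simp)⟩
  refine ⟨?_, fun v hv => ?_⟩
  · obtain ⟨u, u₁, u₂, hu, hu₁, hu₂, ha, hb, hL⟩ :=
      exists_diffJump_solution hab hκ hq hφ h0 h1 hgc
    have hsol := isClassicalSolution_indicator (f := f) (lam := lam) hab hσ hu hu₁ hu₂ ha hb
      fun x hx => (hL x (Ioo_subset_Icc_self hx)).trans (hgf x (Ioo_subset_Icc_self hx))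
    refine ⟨_, hsol, fun v hv => funext fun x => ?_⟩
    by_cases hx : x ∈ Ioo a b
    · have hw := hsol.hasTwoDerivs.const_mul (-1)
      have := (hv.hasTwoDerivs.add hw).eq_zero (κ := μ / σ ^ 2) hab.le hq hφ h0 h1
        (by simp [hbdry v hv]) (by simp [hbdry v hv])
        (fun y hy => by
          rw [diffJumpOp_add hab.le hφ hv.hasTwoDerivs.cont hw.cont, diffJumpOp_const_mul,
            hv.diffJumpOp_eq hσ hy, hsol.diffJumpOp_eq hσ hy]
          ring) x (Ioo_subset_Icc_self hx)
      linarith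
    · rw [hv.1 x hx, hsol.1 x hx]
  · have h := integral_sq_le_of_abs_le hab.le hgc
      (hbound φ hφ h0 h1 g hgc v _ _ hv.hasTwoDerivs (hbdry v hv).1 (hbdry v hv).2
        fun x hx => (hv.diffJumpOp_eq hσ hx).trans (hgf x (Ioo_subset_Icc_self hx)).symm)
    have hgi : ∫ x in a..b, g x ^ 2 = (2 / σ ^ 2) ^ 2 * ∫ x in a..b, f x ^ 2 := by
      rw [← intervalIntegral.integral_const_mul]
      refine intervalIntegral.integral_congr fun x hx => ?_
      rw [uIcc_of_le hab.le] at hx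
      simp only [hgf x hx, mul_pow]
    rw [hgi] at h
    calc L2norm a b (deriv (deriv v)) ≤ Real.sqrt ((2 * E ^ 2 * (b - a) ^ 2 + 2) *
          ((2 / σ ^ 2) ^ 2 * ∫ x in a..b, f x ^ 2)) := Real.sqrt_le_sqrt h
      _ = Real.sqrt (2 * E ^ 2 * (b - a) ^ 2 + 2) * (2 / σ ^ 2) * L2norm a b f := by
        rw [L2norm, Real.sqrt_mul (by positivity), Real.sqrt_mul (by positivity),
          Real.sqrt_sq (by positivity)]
        ring
end

section
/- Let u : ℝ → ℝ be bounded and continuous, twice continuously differentiable on (a,b), and suppose 𝓛u(x) − 𝓙u(x) ≤ 0 for all x ∈ (a,b). Then sup_{x ∈ [a,b]} u(x) ≤ sup_{x ∈ ℝ∖(a,b)} u(x); i.e., the supremum of u over ℝ is attained (as a supremum) on ℝ∖(a,b). -/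
open MeasureTheory

open Filter Topology

/-- Second-order necessary condition at a local maximum. -/
theorem IsLocalMax.deriv_deriv_nonpos {f : ℝ → ℝ} {x : ℝ} (h : IsLocalMax f x)
    (hc : ContinuousAt f x) : deriv (deriv f) x ≤ 0 := by
  by_contra! hpos
  have hmin := isLocalMin_of_deriv_deriv_pos hpos h.deriv_eq_zero hc
  have hconst : f =ᶠ[𝓝 x] fun _ => f x := by
    filter_upwards [h, hmin] with y h₁ h₂ using le_antisymm h₁ h₂
  have hzero : deriv (deriv f) x = 0 := by
    rw [hconst.deriv.deriv_eq]
    simp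
  exact hpos.ne' hzero

/-- A function on `ℝ` with nonzero integral is nonzero somewhere away from the origin. -/
theorem exists_apply_ne_zero_of_integral_ne_zero {φ : ℝ → ℝ} (h : (∫ y, φ y) ≠ 0) :
    ∃ y, y ≠ 0 ∧ φ y ≠ 0 := by
  by_contra! h0
  refine h (integral_eq_zero_of_ae ?_)
  filter_upwards [compl_mem_ae_iff.2 (measure_singleton (0 : ℝ))] with y hy using h0 y hy

/-- If the average of `u (x + y) - u x` against a continuous integrable weight `φ ≥ 0` is
nonnegative at a global maximum `x` of `u`, then `u` takes its maximum on `x + {φ ≠ 0}`. -/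
theorem eq_of_integral_sub_mul_nonneg {φ u : ℝ → ℝ} {x : ℝ} (hφc : Continuous φ)
    (hφ0 : ∀ y, 0 ≤ φ y) (hφi : Integrable φ) (hu : Continuous u)
    (hu_bdd : ∃ C, ∀ x, |u x| ≤ C) (hmax : ∀ z, u z ≤ u x)
    (hint : 0 ≤ ∫ y, (u (x + y) - u x) * φ y) {y : ℝ} (hy : φ y ≠ 0) : u (x + y) = u x := by
  obtain ⟨C, hC⟩ := hu_bdd
  have hcont : Continuous fun y => (u x - u (x + y)) * φ y := by fun_prop
  have hnonneg : 0 ≤ fun y => (u x - u (x + y)) * φ y := fun y =>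
    mul_nonneg (sub_nonneg.2 (hmax _)) (hφ0 y)
  have hi : Integrable fun y => (u x - u (x + y)) * φ y := by
    refine hφi.bdd_mul (c := C + C) (by fun_prop) (Eventually.of_forall fun y => ?_)
    exact (norm_sub_le _ _).trans (add_le_add (hC _) (hC _))
  have hneg : (∫ y, (u x - u (x + y)) * φ y) = -∫ y, (u (x + y) - u x) * φ y := by
    rw [← integral_neg]
    congr 1 with y
    ring
  have hzero : (∫ y, (u x - u (x + y)) * φ y) = 0 :=
    le_antisymm (by linarith) (integral_nonneg hnonneg)
  have hfun := (hcont.ae_eq_iff_eq volume continuous_zero).1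
    ((integral_eq_zero_iff_of_nonneg hnonneg hi).1 hzero)
  have := (mul_eq_zero.1 (congrFun hfun y)).resolve_right hy
  linarith

/-- A nonempty compact set of reals is not closed under a nonzero translation. -/
theorem IsCompact.exists_add_notMem {S : Set ℝ} (hS : IsCompact S) (hne : S.Nonempty) {y : ℝ}
    (hy : y ≠ 0) : ∃ x ∈ S, x + y ∉ S := by
  rcases hy.lt_or_gt with h | h
  · obtain ⟨x, hx, hle⟩ := hS.exists_isLeast hne
    exact ⟨x, hx, fun hxy => by linarith [hle hxy]⟩
  · obtain ⟨x, hx, hle⟩ := hS.exists_isGreatest hne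
    exact ⟨x, hx, fun hxy => by linarith [hle hxy]⟩

/-- Maximum principle: if `u` is bounded and continuous on `ℝ`, twice continuously
differentiable on `(a,b)`, and `𝓛u(x) − 𝓙u(x) ≤ 0` on `(a,b)`, where
`𝓛u(x) = −(σ²/2)u''(x) + μxu'(x)` and `𝓙u(x) = λ∫_ℝ (u(x+y) − u(x))φ(y) dy`,
then `sup_{[a,b]} u ≤ sup_{ℝ∖(a,b)} u`. -/
theorem stmt6 (a b σ μ lam : ℝ) (hab : a < b) (hσ : 0 < σ) (hμ : 0 < μ) (hlam : 0 < lam)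
    (φ : ℝ → ℝ) (hφc : Continuous φ) (hφ0 : ∀ y, 0 ≤ φ y) (hφ1 : (∫ y, φ y) = 1)
    (u : ℝ → ℝ) (hu_cont : Continuous u) (hu_bdd : ∃ C, ∀ x, |u x| ≤ C)
    (hu_C2 : ContDiffOn ℝ 2 u (Set.Ioo a b))
    (hineq : ∀ x ∈ Set.Ioo a b,
      -(σ ^ 2 / 2) * deriv (deriv u) x + μ * x * deriv u x -
        lam * ∫ y, (u (x + y) - u x) * φ y ≤ 0) :
    sSup (u '' Set.Icc a b) ≤ sSup (u '' (Set.Ioo a b)ᶜ) := by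
  have hφi : Integrable φ := by
    by_contra h
    simp [integral_undef h] at hφ1
  obtain ⟨y, hy0, hy⟩ := exists_apply_ne_zero_of_integral_ne_zero (hφ1.trans_ne one_ne_zero)
  have hbdd : BddAbove (u '' (Set.Ioo a b)ᶜ) := by
    obtain ⟨C, hC⟩ := hu_bdd
    exact ⟨C, by rintro _ ⟨x, -, rfl⟩; exact (abs_le.1 (hC x)).2⟩
  obtain ⟨x₀, hx₀, hM, hx₀max⟩ := isCompact_Icc.exists_sSup_image_eq_and_ge
    (Set.nonempty_Icc.2 hab.le) hu_cont.continuousOn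
  rw [hM]
  by_contra! hlt
  have hout : ∀ z, z ∉ Set.Ioo a b → u z < u x₀ := fun z hz =>
    (le_csSup hbdd ⟨z, hz, rfl⟩).trans_lt hlt
  have hmax : ∀ z, u z ≤ u x₀ := fun z => by
    by_cases hz : z ∈ Set.Ioo a b
    · exact hx₀max z (Set.Ioo_subset_Icc_self hz)
    · exact (hout z hz).le
  have hmem : ∀ z, u z = u x₀ → z ∈ Set.Ioo a b := fun z hz => by
    by_contra h
    exact (hout z h).ne hz
  have hcompact : IsCompact {z | u z = u x₀} :=
    isCompact_Icc.of_isClosed_subset (isClosed_eq hu_cont continuous_const)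
      fun z hz => Set.Ioo_subset_Icc_self (hmem z hz)
  obtain ⟨x, hx, hxy⟩ := hcompact.exists_add_notMem ⟨x₀, rfl⟩ hy0
  rw [Set.mem_ofPred_eq] at hx hxy
  have hxmax : ∀ z, u z ≤ u x := fun z => (hmax z).trans_eq hx.symm
  have hloc : IsLocalMax u x := Eventually.of_forall hxmax
  refine hxy ((eq_of_integral_sub_mul_nonneg hφc hφ0 hφi hu_cont hu_bdd hxmax ?_ hy).trans hx)
  have h₁ := hineq x (hmem x hx)
  rw [hloc.deriv_eq_zero] at h₁
  have h₂ : σ ^ 2 / 2 * deriv (deriv u) x ≤ 0 :=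
    mul_nonpos_of_nonneg_of_nonpos (by positivity)
      (hloc.deriv_deriv_nonpos hu_cont.continuousAt)
  exact nonneg_of_mul_nonneg_right (by linarith) hlam
end

section
/- Let γ > 0 satisfy (σ²/2)γ² − μbγ − λ ≥ 1, and define the barrier φ_γ(x) = e^{γ(b−a)} − e^{γ(x−a)} for x ≤ b and φ_γ(x) = 0 for x > b. Then for every x ∈ (a,b): −(σ²/2)φ_γ''(x) + μ x φ_γ'(x) − λ ∫_ℝ (φ_γ(x+y) − φ_γ(x)) φ(y) dy ≥ 1. -/
open MeasureTheory

/-- Barrier function computation: if `γ > 0` satisfies `(σ²/2)γ² − μbγ − λ ≥ 1` and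
`φ_γ(x) = e^{γ(b−a)} − e^{γ(x−a)}` for `x ≤ b`, `φ_γ(x) = 0` for `x > b`, then for every
`x ∈ (a,b)`:
`−(σ²/2)φ_γ''(x) + μxφ_γ'(x) − λ∫_ℝ (φ_γ(x+y) − φ_γ(x))φ(y) dy ≥ 1`. -/
theorem stmt8 (a b σ μ lam : ℝ) (hab : a < b) (hσ : 0 < σ) (hμ : 0 < μ) (hlam : 0 < lam)
    (φ : ℝ → ℝ) (hφc : Continuous φ) (hφ0 : ∀ y, 0 ≤ φ y) (hφ1 : (∫ y, φ y) = 1)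
    (γ : ℝ) (hγ : 0 < γ) (hγ1 : (σ ^ 2 / 2) * γ ^ 2 - μ * b * γ - lam ≥ 1)
    (φγ : ℝ → ℝ)
    (hφγ : ∀ x : ℝ, φγ x =
      if x ≤ b then Real.exp (γ * (b - a)) - Real.exp (γ * (x - a)) else 0) :
    ∀ x ∈ Set.Ioo a b,
      -(σ ^ 2 / 2) * deriv (deriv φγ) x + μ * x * deriv φγ x -
        lam * ∫ y, (φγ (x + y) - φγ x) * φ y ≥ 1 := by
  intro x hx
  obtain ⟨hax, hxb⟩ := hx
  have hval : ∀ z, z < b →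
      φγ z = Real.exp (γ * (b - a)) - Real.exp (γ * (z - a)) := fun z hz => by
    rw [hφγ, if_pos hz.le]
  have hexp : ∀ z, HasDerivAt (fun t => Real.exp (γ * (t - a)))
      (γ * Real.exp (γ * (z - a))) z := fun z => by
    simpa [mul_comm] using (((hasDerivAt_id z).sub_const a).const_mul γ).exp
  have hderiv : ∀ z, z < b → deriv φγ z = -(γ * Real.exp (γ * (z - a))) := fun z hz =>
    (((hexp z).const_sub _).congr_of_eventuallyEq
      ((eventually_lt_nhds hz).mono hval)).deriv
  have hderiv2 : deriv (deriv φγ) x = -(γ * (γ * Real.exp (γ * (x - a)))) :=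
    (((hexp x).const_mul γ).neg.congr_of_eventuallyEq
      ((eventually_lt_nhds hxb).mono hderiv)).deriv
  have hbound : ∀ y, φγ (x + y) - φγ x ≤ Real.exp (γ * (x - a)) := fun y => by
    rw [hval x hxb, hφγ]
    split_ifs
    · linarith [Real.exp_pos (γ * (x + y - a))]
    · linarith [Real.exp_pos (γ * (b - a))]
  have hint : ∫ y, (φγ (x + y) - φγ x) * φ y ≤ Real.exp (γ * (x - a)) := by
    by_cases hf : Integrable fun y => (φγ (x + y) - φγ x) * φ y
    · have hφi : Integrable φ := by
        by_contra h
        simp [integral_undef h] at hφ1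
      calc ∫ y, (φγ (x + y) - φγ x) * φ y
          ≤ ∫ y, Real.exp (γ * (x - a)) * φ y :=
            integral_mono hf (hφi.const_mul _) fun y =>
              mul_le_mul_of_nonneg_right (hbound y) (hφ0 y)
        _ = Real.exp (γ * (x - a)) := by rw [integral_const_mul, hφ1, mul_one]
    · rw [integral_undef hf]
      positivity
  rw [hderiv2, hderiv x hxb]
  have hone : 1 ≤ Real.exp (γ * (x - a)) :=
    Real.one_le_exp (mul_nonneg hγ.le (sub_nonneg.2 hax.le))
  generalize Real.exp (γ * (x - a)) = E at hint hone ⊢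
  have hdrift : μ * γ * E * x ≤ μ * γ * E * b :=
    mul_le_mul_of_nonneg_left hxb.le (by positivity)
  have hjump := mul_le_mul_of_nonneg_left hint hlam.le
  have hmain := mul_le_mul_of_nonneg_right hγ1 (zero_le_one.trans hone)
  linarith
end

section
/- Let v be a classical solution of the boundary value problem with data f ∈ C([a,b]) and let v_h ∈ V_h be a Galerkin solution with the same data, on a mesh with mesh size h; set e = v − v_h. Let c₁ = σ²/2 + c₂(μ max(|a|,|b|) + 2λc₂) with c₂ = (b−a)/π, and suppose w ∈ C¹([a,b]) with w(a) = w(b) = 0 has a locally absolutely continuous derivative with second derivative w'' ∈ L²(a,b), satisfies the adjoint identity A(ψ, w) = ∫_a^b ψ(x) e(x) dx for every continuous piecewise C¹ function ψ on [a,b] vanishing at a and b, and satisfies ‖w''‖ ≤ c₃ ‖e‖ for some constant c₃ > 0. Then ‖e‖ ≤ c₁ c₃ h ‖e'‖, where ‖·‖ is the L²(a,b)-norm. -/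
open MeasureTheory

/-- The bilinear form `A(u,v) = ∫_a^b ((σ²/2)u'v' + μxu'v) dx − ∫_a^b 𝓘u v dx`
(derivatives taken a.e. via `deriv`). -/
noncomputable def AbilD (a b σ μ lam : ℝ) (φ u v : ℝ → ℝ) : ℝ :=
  (∫ x in a..b, ((σ ^ 2 / 2) * deriv u x * deriv v x + μ * x * deriv u x * v x)) -
    ∫ x in a..b, Iop a b lam φ u x * v x

/-- Membership in the finite element space `V_h`: continuous piecewise affine on the mesh,
vanishing at `a` and `b`, extended by zero outside `(a,b)`. -/
def MemVh (a b : ℝ) (N : ℕ) (xs : ℕ → ℝ) (w : ℝ → ℝ) : Prop :=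
  (∀ x, x ∉ Set.Ioo a b → w x = 0) ∧
  ∀ j < N, ∃ p q : ℝ, ∀ x ∈ Set.Icc (xs j) (xs (j + 1)), w x = p * x + q

/-- `vh` is a Galerkin solution with data `f`: `vh ∈ V_h` and
`A(vh, φh) = ∫_a^b f φh dx` for all `φh ∈ V_h`. -/
def IsGalerkinSolution (a b σ μ lam : ℝ) (φ f : ℝ → ℝ) (N : ℕ) (xs : ℕ → ℝ)
    (vh : ℝ → ℝ) : Prop :=
  MemVh a b N xs vh ∧
  ∀ φh : ℝ → ℝ, MemVh a b N xs φh →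
    AbilD a b σ μ lam φ vh φh = ∫ x in a..b, f x * φh x

/-- A continuous piecewise `C¹` test function on `[a,b]` vanishing at `a` and `b`
(extended by zero). -/
def IsPiecewiseC1Test (a b : ℝ) (ψ : ℝ → ℝ) : Prop :=
  ContinuousOn ψ (Set.Icc a b) ∧ (∀ x, x ∉ Set.Ioo a b → ψ x = 0) ∧
  ∃ M : ℕ, 0 < M ∧ ∃ ys : ℕ → ℝ, ys 0 = a ∧ ys M = b ∧ (∀ j < M, ys j < ys (j + 1)) ∧
    ∀ j < M, ContDiffOn ℝ 1 ψ (Set.Icc (ys j) (ys (j + 1)))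

/-- Cauchy–Schwarz inequality for real square-integrable functions. -/
theorem sq_integral_mul_le {α : Type*} [MeasurableSpace α] {ν : Measure α} {f g : α → ℝ}
    (hf : MemLp f 2 ν) (hg : MemLp g 2 ν) :
    (∫ x, f x * g x ∂ν) ^ 2 ≤ (∫ x, f x ^ 2 ∂ν) * ∫ x, g x ^ 2 ∂ν := by
  have hfg : Integrable (fun x => f x * g x) ν := hf.integrable_mul hg
  have key : ∀ t : ℝ, 0 ≤ (∫ x, f x ^ 2 ∂ν) * (t * t) + (2 * ∫ x, f x * g x ∂ν) * t +
      ∫ x, g x ^ 2 ∂ν := by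
    intro t
    have h0 : 0 ≤ ∫ x, (t * f x + g x) ^ 2 ∂ν := integral_nonneg fun x => sq_nonneg _
    have h1 : ∫ x, (t * f x + g x) ^ 2 ∂ν =
        ∫ x, ((t * t) * f x ^ 2 + (2 * t) * (f x * g x)) + g x ^ 2 ∂ν := by
      congr 1; ext x; ring
    have hA : Integrable (fun x => (t * t) * f x ^ 2) ν := hf.integrable_sq.const_mul _
    have hB : Integrable (fun x => (2 * t) * (f x * g x)) ν := hfg.const_mul _
    have hAB : Integrable (fun x => (t * t) * f x ^ 2 + (2 * t) * (f x * g x)) ν := hA.add hB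
    rw [h1, integral_add hAB hg.integrable_sq, integral_add hA hB, integral_const_mul,
      integral_const_mul] at h0
    linarith
  have := discrim_le_zero key
  unfold discrim at this
  nlinarith

theorem memLp_two_of_intervalIntegrable {a b : ℝ} (hab : a ≤ b) {f : ℝ → ℝ}
    (hf : IntervalIntegrable f volume a b)
    (hf2 : IntervalIntegrable (fun x => f x ^ 2) volume a b) :
    MemLp f 2 (volume.restrict (Set.Ioc a b)) := by
  rw [intervalIntegrable_iff_integrableOn_Ioc_of_le hab] at hf hf2
  exact (memLp_two_iff_integrable_sq hf.aestronglyMeasurable).2 hf2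

theorem sq_intervalIntegral_mul_le {a b : ℝ} (hab : a ≤ b) {f g : ℝ → ℝ}
    (hf : MemLp f 2 (volume.restrict (Set.Ioc a b)))
    (hg : MemLp g 2 (volume.restrict (Set.Ioc a b))) :
    (∫ x in a..b, f x * g x) ^ 2 ≤ (∫ x in a..b, f x ^ 2) * ∫ x in a..b, g x ^ 2 := by
  simp only [intervalIntegral.integral_of_le hab]
  exact sq_integral_mul_le hf hg

theorem sq_intervalIntegral_le {a b : ℝ} (hab : a ≤ b) {f : ℝ → ℝ}
    (hf : IntervalIntegrable f volume a b)
    (hf2 : IntervalIntegrable (fun x => f x ^ 2) volume a b) :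
    (∫ x in a..b, f x) ^ 2 ≤ (b - a) * ∫ x in a..b, f x ^ 2 := by
  have := sq_intervalIntegral_mul_le hab (f := fun _ => 1) (memLp_const 1)
    (memLp_two_of_intervalIntegrable hab hf hf2)
  simpa using this

/-- Poincaré inequality for a continuous function vanishing at both end points and
differentiable off a countable set. -/
theorem integral_sq_le_of_hasDerivAt {a b : ℝ} (hab : a < b) {S : Set ℝ} (hS : S.Countable)
    {u u' : ℝ → ℝ} (hu : ContinuousOn u (Set.Icc a b)) (hua : u a = 0) (hub : u b = 0)
    (hd : ∀ x ∈ Set.Ioo a b \ S, HasDerivAt u (u' x) x)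
    (hi : IntervalIntegrable u' volume a b)
    (hi2 : IntervalIntegrable (fun x => u' x ^ 2) volume a b) :
    ∫ x in a..b, u x ^ 2 ≤ (b - a) ^ 2 / 6 * ∫ x in a..b, u' x ^ 2 := by
  have hba : 0 < b - a := sub_pos.2 hab
  set D := ∫ x in a..b, u' x ^ 2
  have hpt : ∀ x ∈ Set.Icc a b, u x ^ 2 ≤ D / (b - a) * ((x - a) * (b - x)) := by
    intro x hx
    have s1 : Set.uIcc a x ⊆ Set.uIcc a b := by
      rw [Set.uIcc_of_le hx.1, Set.uIcc_of_le hab.le]; exact Set.Icc_subset_Icc_right hx.2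
    have s2 : Set.uIcc x b ⊆ Set.uIcc a b := by
      rw [Set.uIcc_of_le hx.2, Set.uIcc_of_le hab.le]; exact Set.Icc_subset_Icc_left hx.1
    have e1 : ∫ t in a..x, u' t = u x - u a :=
      integral_eq_of_hasDerivAt_off_countable_of_le u u' hx.1 hS
        (hu.mono (Set.Icc_subset_Icc_right hx.2))
        (fun t ht => hd t ⟨⟨ht.1.1, ht.1.2.trans_le hx.2⟩, ht.2⟩) (hi.mono_set s1)
    have e2 : ∫ t in x..b, u' t = u b - u x :=
      integral_eq_of_hasDerivAt_off_countable_of_le u u' hx.2 hS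
        (hu.mono (Set.Icc_subset_Icc_left hx.1))
        (fun t ht => hd t ⟨⟨hx.1.trans_lt ht.1.1, ht.1.2⟩, ht.2⟩) (hi.mono_set s2)
    have c1 := sq_intervalIntegral_le hx.1 (hi.mono_set s1) (hi2.mono_set s1)
    have c2 := sq_intervalIntegral_le hx.2 (hi.mono_set s2) (hi2.mono_set s2)
    have hD : (∫ t in a..x, u' t ^ 2) + ∫ t in x..b, u' t ^ 2 = D :=
      intervalIntegral.integral_add_adjacent_intervals (hi2.mono_set s1) (hi2.mono_set s2)
    rw [e1, hua] at c1
    rw [e2, hub] at c2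
    have h1 := mul_le_mul_of_nonneg_left c1 (sub_nonneg.2 hx.2)
    have h2 := mul_le_mul_of_nonneg_left c2 (sub_nonneg.2 hx.1)
    rw [← hD, div_mul_eq_mul_div, le_div_iff₀ hba]
    nlinarith
  have hcu : IntervalIntegrable (fun x => u x ^ 2) volume a b :=
    ContinuousOn.intervalIntegrable (by rw [Set.uIcc_of_le hab.le]; exact hu.pow 2)
  have hpoly : ∫ x in a..b, D / (b - a) * ((x - a) * (b - x)) = (b - a) ^ 2 / 6 * D := by
    have hF : ∀ x ∈ Set.uIcc a b,
        HasDerivAt (fun x => (x - a) ^ 2 * (b - a) / 2 - (x - a) ^ 3 / 3)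
          ((x - a) * (b - x)) x := by
      intro x _
      have h1 := (hasDerivAt_id x).sub_const a
      refine ((((h1.pow 2).mul_const (b - a)).div_const 2).sub
        ((h1.pow 3).div_const 3)).congr_deriv ?_
      simp
      ring
    rw [intervalIntegral.integral_const_mul, intervalIntegral.integral_eq_sub_of_hasDerivAt hF
      (Continuous.intervalIntegrable (by fun_prop) _ _)]
    field_simp
    ring
  rw [← hpoly]
  exact intervalIntegral.integral_mono_on hab.le hcu
    (Continuous.intervalIntegrable (by fun_prop) _ _) hpt

/-- Hölder estimate for a continuous primitive of a function with integrable square.  No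
measurability of `g'` is assumed: where `g'` fails to be integrable, the primitive is constant. -/
theorem sq_sub_le_of_eq_add_integral {a b : ℝ} {g g' : ℝ → ℝ}
    (hg : ContinuousOn g (Set.Icc a b))
    (hAC : ∀ x ∈ Set.Icc a b, g x = g a + ∫ t in a..x, g' t)
    (hi2 : IntervalIntegrable (fun x => g' x ^ 2) volume a b)
    {x y : ℝ} (hax : a ≤ x) (hxy : x ≤ y) (hyb : y ≤ b) :
    (g y - g x) ^ 2 ≤ (y - x) * ∫ t in x..y, g' t ^ 2 := by
  have hab : a ≤ b := hax.trans (hxy.trans hyb)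
  have hsub : ∀ {x y : ℝ}, a ≤ x → x ≤ y → y ≤ b → Set.uIcc x y ⊆ Set.uIcc a b := by
    intro x y h1 h2 h3
    rw [Set.uIcc_of_le h2, Set.uIcc_of_le hab]; exact Set.Icc_subset_Icc h1 h3
  have hmono : ∀ {x y z : ℝ}, a ≤ x → x ≤ y → y ≤ z → z ≤ b →
      ∫ t in x..y, g' t ^ 2 ≤ ∫ t in x..z, g' t ^ 2 := by
    intro x y z h1 h2 h3 h4
    exact intervalIntegral.integral_mono_interval le_rfl h2 h3
      (Filter.Eventually.of_forall fun t => sq_nonneg _)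
      (hi2.mono_set (hsub h1 (h2.trans h3) h4))
  have hint : ∀ {x y : ℝ}, a ≤ x → x ≤ y → y ≤ b → IntervalIntegrable g' volume a y →
      (g y - g x) ^ 2 ≤ (y - x) * ∫ t in x..y, g' t ^ 2 := by
    intro x y h1 h2 h3 hI
    have hIx : IntervalIntegrable g' volume a x := hI.mono_set (by
      rw [Set.uIcc_of_le h1, Set.uIcc_of_le (h1.trans h2)]; exact Set.Icc_subset_Icc_right h2)
    have hIxy : IntervalIntegrable g' volume x y := hIx.symm.trans hI
    have := sq_intervalIntegral_le h2 hIxy (hi2.mono_set (hsub h1 h2 h3))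
    rw [hAC y ⟨h1.trans h2, h3⟩, hAC x ⟨h1, h2.trans h3⟩,
      ← intervalIntegral.integral_add_adjacent_intervals hIx hIxy]
    convert this using 2
    ring
  set J : Set ℝ := {z | z ∈ Set.Icc a b ∧ IntervalIntegrable g' volume a z}
  have haJ : a ∈ J := ⟨⟨le_rfl, hab⟩, by simp⟩
  have hJb : BddAbove J := ⟨b, fun z hz => hz.1.2⟩
  set c := sSup J
  have hac : a ≤ c := le_csSup hJb haJ
  have hcb : c ≤ b := csSup_le ⟨a, haJ⟩ fun z hz => hz.1.2
  have hlow : ∀ z, a ≤ z → z < c → IntervalIntegrable g' volume a z := by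
    intro z h1 h2
    obtain ⟨s, hs, hzs⟩ := exists_lt_of_lt_csSup ⟨a, haJ⟩ h2
    exact hs.2.mono_set (by
      rw [Set.uIcc_of_le h1, Set.uIcc_of_le hs.1.1]; exact Set.Icc_subset_Icc_right hzs.le)
  have hhigh : ∀ z, c < z → z ≤ b → g z = g a := by
    intro z h1 h2
    have hn : ¬ IntervalIntegrable g' volume a z := fun hI =>
      absurd (le_csSup hJb (show z ∈ J from ⟨⟨hac.trans h1.le, h2⟩, hI⟩)) (not_le.2 h1)
    rw [hAC z ⟨hac.trans h1.le, h2⟩, intervalIntegral.integral_undef hn, add_zero]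
  have hat : ∀ x, a ≤ x → x ≤ c → (g c - g x) ^ 2 ≤ (c - x) * ∫ t in x..c, g' t ^ 2 := by
    intro x h1 h2
    rcases h2.eq_or_lt with rfl | h2
    · simp
    have hc : ContinuousWithinAt g (Set.Ioo x c) c :=
      (hg c ⟨hac, hcb⟩).mono fun t ht => ⟨h1.trans ht.1.le, ht.2.le.trans hcb⟩
    have : (nhdsWithin c (Set.Ioo x c)).NeBot := by
      rw [← mem_closure_iff_nhdsWithin_neBot, closure_Ioo h2.ne]; exact ⟨h2.le, le_rfl⟩
    refine le_of_tendsto ((hc.tendsto.sub_const (g x)).pow 2) ?_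
    filter_upwards [self_mem_nhdsWithin] with z hz
    have hzb := hz.2.le.trans hcb
    refine (hint h1 hz.1.le hzb (hlow z (h1.trans hz.1.le) hz.2)).trans ?_
    have h5 := hmono h1 hz.1.le hz.2.le hcb
    have h6 : 0 ≤ ∫ t in x..z, g' t ^ 2 :=
      intervalIntegral.integral_nonneg hz.1.le fun t _ => sq_nonneg _
    exact mul_le_mul (by linarith [hz.2]) h5 h6 (by linarith)
  have hconst : ∀ z, c ≤ z → z ≤ b → g z = g c := by
    intro z h1 h2
    rcases h1.eq_or_lt with rfl | h1
    · rfl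
    have hc : ContinuousWithinAt g (Set.Ioo c z) c :=
      (hg c ⟨hac, hcb⟩).mono fun t ht => ⟨hac.trans ht.1.le, ht.2.le.trans h2⟩
    have : (nhdsWithin c (Set.Ioo c z)).NeBot := by
      rw [← mem_closure_iff_nhdsWithin_neBot, closure_Ioo h1.ne]; exact ⟨le_rfl, h1.le⟩
    have h3 : Filter.Tendsto g (nhdsWithin c (Set.Ioo c z)) (nhds (g a)) := by
      refine tendsto_const_nhds.congr' ?_
      filter_upwards [self_mem_nhdsWithin] with t ht
      exact (hhigh t ht.1 (ht.2.le.trans h2)).symm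
    rw [hhigh z h1 h2, tendsto_nhds_unique hc.tendsto h3]
  rcases lt_or_ge y c with hyc | hyc
  · exact hint hax hxy hyb (hlow y (hax.trans hxy) hyc)
  rw [hconst y hyc hyb]
  have h6 : 0 ≤ ∫ t in x..y, g' t ^ 2 :=
    intervalIntegral.integral_nonneg hxy fun t _ => sq_nonneg _
  rcases le_or_gt x c with hxc | hxc
  · refine (hat x hax hxc).trans (mul_le_mul (by linarith) (hmono hax hxc hyc hyb) ?_ (by linarith))
    exact intervalIntegral.integral_nonneg hxc fun t _ => sq_nonneg _
  · rw [hconst x hxc.le (hxy.trans hyb)]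
    have := mul_nonneg (sub_nonneg.2 hxy) h6
    simpa using this

theorem intervalIntegral_abs_sub {p q x : ℝ} (hx : x ∈ Set.Icc p q) :
    ∫ y in p..q, |x - y| = ((x - p) ^ 2 + (q - x) ^ 2) / 2 := by
  rw [← intervalIntegral.integral_add_adjacent_intervals (b := x)
    (Continuous.intervalIntegrable (by fun_prop) _ _)
    (Continuous.intervalIntegrable (by fun_prop) _ _)]
  have h1 : ∫ y in p..x, |x - y| = ∫ y in p..x, (x - y) := by
    refine intervalIntegral.integral_congr fun y hy => ?_
    rw [Set.uIcc_of_le hx.1] at hy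
    exact abs_of_nonneg (sub_nonneg.2 hy.2)
  have h2 : ∫ y in x..q, |x - y| = ∫ y in x..q, (y - x) := by
    refine intervalIntegral.integral_congr fun y hy => ?_
    rw [Set.uIcc_of_le hx.2] at hy
    rw [abs_sub_comm]
    exact abs_of_nonneg (sub_nonneg.2 hy.1)
  rw [h1, h2, intervalIntegral.integral_sub (Continuous.intervalIntegrable (by fun_prop) _ _)
    (Continuous.intervalIntegrable (by fun_prop) _ _), intervalIntegral.integral_sub
    (Continuous.intervalIntegrable (by fun_prop) _ _)
    (Continuous.intervalIntegrable (by fun_prop) _ _)]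
  simp
  ring

/-- A function whose increments satisfy a Hölder estimate is close in `L²` to its mean. -/
theorem integral_sq_sub_mean_le {p q D m : ℝ} (hpq : p < q) {g : ℝ → ℝ}
    (hg : ContinuousOn g (Set.Icc p q))
    (hD : ∀ x ∈ Set.Icc p q, ∀ y ∈ Set.Icc p q, (g x - g y) ^ 2 ≤ |x - y| * D)
    (hm : ∫ y in p..q, g y = (q - p) * m) :
    ∫ x in p..q, (g x - m) ^ 2 ≤ (q - p) ^ 2 / 3 * D := by
  have hL : 0 < q - p := sub_pos.2 hpq
  have hci : ∀ {F : ℝ → ℝ}, ContinuousOn F (Set.Icc p q) → IntervalIntegrable F volume p q :=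
    fun hF => ContinuousOn.intervalIntegrable (by rwa [Set.uIcc_of_le hpq.le])
  have hpt : ∀ x ∈ Set.Icc p q,
      (g x - m) ^ 2 ≤ D / (q - p) * (((x - p) ^ 2 + (q - x) ^ 2) / 2) := by
    intro x hx
    have e1 : ∫ y in p..q, (g x - g y) = (q - p) * (g x - m) := by
      rw [intervalIntegral.integral_sub (by simp) (hci hg), hm]
      simp
      ring
    have e2 := sq_intervalIntegral_le hpq.le (f := fun y => g x - g y)
      (hci (continuousOn_const.sub hg)) (hci ((continuousOn_const.sub hg).pow 2))
    have e3 : ∫ y in p..q, (g x - g y) ^ 2 ≤ ∫ y in p..q, |x - y| * D :=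
      intervalIntegral.integral_mono_on hpq.le (hci ((continuousOn_const.sub hg).pow 2))
        (Continuous.intervalIntegrable (by fun_prop) _ _) fun y hy => hD x hx y hy
    rw [intervalIntegral.integral_mul_const, intervalIntegral_abs_sub hx] at e3
    rw [e1] at e2
    have e4 := e2.trans (mul_le_mul_of_nonneg_left e3 hL.le)
    rw [div_mul_eq_mul_div, le_div_iff₀ hL]
    refine le_of_mul_le_mul_left ?_ hL
    nlinarith
  have hpoly : ∫ x in p..q, D / (q - p) * (((x - p) ^ 2 + (q - x) ^ 2) / 2) =
      (q - p) ^ 2 / 3 * D := by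
    have hF : ∀ x ∈ Set.uIcc p q,
        HasDerivAt (fun x => (x - p) ^ 3 / 6 - (q - x) ^ 3 / 6)
          (((x - p) ^ 2 + (q - x) ^ 2) / 2) x := by
      intro x _
      have h1 := (hasDerivAt_id x).sub_const p
      have h2 := (hasDerivAt_id x).const_sub q
      refine (((h1.pow 3).div_const 6).sub ((h2.pow 3).div_const 6)).congr_deriv ?_
      simp
      ring
    rw [intervalIntegral.integral_const_mul, intervalIntegral.integral_eq_sub_of_hasDerivAt hF
      (Continuous.intervalIntegrable (by fun_prop) _ _)]
    field_simp
    ring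
  rw [← hpoly]
  exact intervalIntegral.integral_mono_on hpq.le (hci ((hg.sub continuousOn_const).pow 2))
    (Continuous.intervalIntegrable (by fun_prop) _ _) hpt

theorem intervalIntegral_le_one {φ : ℝ → ℝ} (hφ0 : ∀ y, 0 ≤ φ y) (hφ1 : (∫ y, φ y) = 1)
    {c d : ℝ} (hcd : c ≤ d) : ∫ y in c..d, φ y ≤ 1 := by
  have hi : Integrable φ := by
    by_contra hn
    rw [integral_undef hn] at hφ1
    exact zero_ne_one hφ1
  rw [intervalIntegral.integral_of_le hcd, ← hφ1]
  exact setIntegral_le_integral hi (Filter.Eventually.of_forall hφ0)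

/-- Young's inequality for the convolution with a probability density on an interval. -/
theorem integral_sq_convolution_le {a b : ℝ} (hab : a ≤ b) {φ e : ℝ → ℝ} (hφc : Continuous φ)
    (hφ0 : ∀ y, 0 ≤ φ y) (hφ1 : (∫ y, φ y) = 1) (he : Continuous e) :
    ∫ x in a..b, (∫ y in a..b, φ (x - y) * e y) ^ 2 ≤ ∫ x in a..b, e x ^ 2 := by
  have hK : Continuous fun x => ∫ y in a..b, φ (x - y) * e y :=
    intervalIntegral.continuous_parametric_intervalIntegral_of_continuous'
      (f := fun x y => φ (x - y) * e y) (by unfold Function.uncurry; fun_prop) a b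
  have hK2 : Continuous fun x => ∫ y in a..b, φ (x - y) * e y ^ 2 :=
    intervalIntegral.continuous_parametric_intervalIntegral_of_continuous'
      (f := fun x y => φ (x - y) * e y ^ 2) (by unfold Function.uncurry; fun_prop) a b
  have hK3 : Continuous fun y => ∫ x in a..b, φ (x - y) * e y ^ 2 :=
    intervalIntegral.continuous_parametric_intervalIntegral_of_continuous'
      (f := fun y x => φ (x - y) * e y ^ 2) (by unfold Function.uncurry; fun_prop) a b
  have hpt : ∀ x, (∫ y in a..b, φ (x - y) * e y) ^ 2 ≤ ∫ y in a..b, φ (x - y) * e y ^ 2 := by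
    intro x
    have hf : Continuous fun y => Real.sqrt (φ (x - y)) := by fun_prop
    have hg : Continuous fun y => Real.sqrt (φ (x - y)) * e y := by fun_prop
    have h1 := sq_intervalIntegral_mul_le hab
      (memLp_two_of_intervalIntegrable hab (hf.intervalIntegrable a b)
        ((hf.pow 2).intervalIntegrable a b))
      (memLp_two_of_intervalIntegrable hab (hg.intervalIntegrable a b)
        ((hg.pow 2).intervalIntegrable a b))
    simp only [mul_pow, ← mul_assoc, Real.mul_self_sqrt (hφ0 _), Real.sq_sqrt (hφ0 _)] at h1
    have h2 : ∫ y in a..b, φ (x - y) ≤ 1 := by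
      rw [intervalIntegral.integral_comp_sub_left]
      exact intervalIntegral_le_one hφ0 hφ1 (by linarith)
    have h3 : 0 ≤ ∫ y in a..b, φ (x - y) * e y ^ 2 :=
      intervalIntegral.integral_nonneg hab fun y _ => mul_nonneg (hφ0 _) (sq_nonneg _)
    nlinarith
  have hswap : ∫ x in a..b, ∫ y in a..b, φ (x - y) * e y ^ 2 =
      ∫ y in a..b, ∫ x in a..b, φ (x - y) * e y ^ 2 := by
    simp only [intervalIntegral.integral_of_le hab]
    refine integral_integral_swap (f := fun x y => φ (x - y) * e y ^ 2) ?_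
    rw [Measure.prod_restrict]
    have hc : Continuous (Function.uncurry fun x y => φ (x - y) * e y ^ 2) := by
      unfold Function.uncurry; fun_prop
    exact (hc.continuousOn.integrableOn_compact
      (isCompact_Icc (a := a) (b := b) |>.prod (isCompact_Icc (a := a) (b := b)))).mono_set
      (Set.prod_mono Set.Ioc_subset_Icc_self Set.Ioc_subset_Icc_self)
  calc ∫ x in a..b, (∫ y in a..b, φ (x - y) * e y) ^ 2
      ≤ ∫ x in a..b, ∫ y in a..b, φ (x - y) * e y ^ 2 :=
        intervalIntegral.integral_mono_on hab ((hK.pow 2).intervalIntegrable _ _)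
          (hK2.intervalIntegrable _ _) fun x _ => hpt x
    _ = ∫ y in a..b, ∫ x in a..b, φ (x - y) * e y ^ 2 := hswap
    _ ≤ ∫ y in a..b, e y ^ 2 := by
        refine intervalIntegral.integral_mono_on hab (hK3.intervalIntegrable _ _)
          ((he.pow 2).intervalIntegrable _ _) fun y _ => ?_
        rw [intervalIntegral.integral_mul_const, intervalIntegral.integral_comp_sub_right]
        exact mul_le_of_le_one_left (sq_nonneg _) (intervalIntegral_le_one hφ0 hφ1 (by linarith))

theorem continuous_Iop (a b lam : ℝ) {φ e : ℝ → ℝ} (hφc : Continuous φ) (he : Continuous e) :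
    Continuous (Iop a b lam φ e) := by
  have hK : Continuous fun x => ∫ y in a..b, φ (x - y) * e y :=
    intervalIntegral.continuous_parametric_intervalIntegral_of_continuous'
      (f := fun x y => φ (x - y) * e y) (by unfold Function.uncurry; fun_prop) a b
  exact continuous_const.mul (hK.sub he)

theorem integral_sq_Iop_le {a b lam : ℝ} (hab : a ≤ b) {φ e : ℝ → ℝ} (hφc : Continuous φ)
    (hφ0 : ∀ y, 0 ≤ φ y) (hφ1 : (∫ y, φ y) = 1) (he : Continuous e) :
    ∫ x in a..b, Iop a b lam φ e x ^ 2 ≤ (2 * lam) ^ 2 * ∫ x in a..b, e x ^ 2 := by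
  have hK : Continuous fun x => ∫ y in a..b, φ (x - y) * e y :=
    intervalIntegral.continuous_parametric_intervalIntegral_of_continuous'
      (f := fun x y => φ (x - y) * e y) (by unfold Function.uncurry; fun_prop) a b
  have hY := integral_sq_convolution_le hab hφc hφ0 hφ1 he
  have h1 : ∫ x in a..b, Iop a b lam φ e x ^ 2 ≤
      ∫ x in a..b, 2 * lam ^ 2 * ((∫ y in a..b, φ (x - y) * e y) ^ 2 + e x ^ 2) := by
    refine intervalIntegral.integral_mono_on hab
      (((continuous_Iop a b lam hφc he).pow 2).intervalIntegrable _ _)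
      ((continuous_const.mul ((hK.pow 2).add (he.pow 2))).intervalIntegrable _ _) fun x _ => ?_
    unfold Iop
    nlinarith [mul_nonneg (sq_nonneg lam) (sq_nonneg ((∫ y in a..b, φ (x - y) * e y) + e x))]
  have hiK : IntervalIntegrable (fun x => (∫ y in a..b, φ (x - y) * e y) ^ 2) volume a b :=
    (hK.pow 2).intervalIntegrable _ _
  have hie : IntervalIntegrable (fun x => e x ^ 2) volume a b := (he.pow 2).intervalIntegrable _ _
  rw [intervalIntegral.integral_const_mul, intervalIntegral.integral_add hiK hie] at h1
  nlinarith [sq_nonneg lam]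

section Mesh

variable {N : ℕ} {xs : ℕ → ℝ}

theorem mesh_le (hmono : ∀ j < N, xs j < xs (j + 1)) {i j : ℕ} (hij : i ≤ j) (hj : j ≤ N) :
    xs i ≤ xs j := by
  induction j, hij using Nat.le_induction with
  | base => exact le_rfl
  | succ k _ ih => exact (ih (by omega)).trans (hmono k (by omega)).le

theorem exists_mem_Ico_of_mesh {x : ℝ} (hx : x ∈ Set.Ico (xs 0) (xs N)) :
    ∃ j < N, x ∈ Set.Ico (xs j) (xs (j + 1)) := by
  induction N with
  | zero => exact absurd (hx.1.trans_lt hx.2) (lt_irrefl _)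
  | succ n ih =>
    rcases lt_or_ge x (xs n) with h | h
    · obtain ⟨j, hj, hxj⟩ := ih ⟨hx.1, h⟩
      exact ⟨j, by omega, hxj⟩
    · exact ⟨n, by omega, h, hx.2⟩

/-- The piecewise affine interpolant of `g` on the mesh `xs`, normalised to vanish at `xs 0`. -/
noncomputable def meshInterp (N : ℕ) (xs : ℕ → ℝ) (g : ℝ → ℝ) (x : ℝ) : ℝ :=
  ∑ j ∈ Finset.range N, (g (xs (j + 1)) - g (xs j)) *
    ((min (max x (xs j)) (xs (j + 1)) - xs j) / (xs (j + 1) - xs j))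

theorem meshInterp_eq_zero_of_le (hmono : ∀ j < N, xs j < xs (j + 1)) (g : ℝ → ℝ) {x : ℝ}
    (hx : x ≤ xs 0) : meshInterp N xs g x = 0 := by
  refine Finset.sum_eq_zero fun j hj => ?_
  have hjN := Finset.mem_range.1 hj
  have h1 : x ≤ xs j := hx.trans (mesh_le hmono (Nat.zero_le j) hjN.le)
  rw [max_eq_right h1, min_eq_left (hmono j hjN).le]
  simp

theorem meshInterp_eq_of_ge (hmono : ∀ j < N, xs j < xs (j + 1)) (g : ℝ → ℝ) {x : ℝ}
    (hx : xs N ≤ x) : meshInterp N xs g x = g (xs N) - g (xs 0) := by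
  rw [← Finset.sum_range_sub (fun j => g (xs j))]
  refine Finset.sum_congr rfl fun j hj => ?_
  have hjN := Finset.mem_range.1 hj
  have h1 : xs (j + 1) ≤ x := (mesh_le hmono hjN le_rfl).trans hx
  rw [max_eq_left ((hmono j hjN).le.trans h1), min_eq_right h1,
    div_self (sub_pos.2 (hmono j hjN)).ne', mul_one]

theorem meshInterp_eq_of_mem (hmono : ∀ j < N, xs j < xs (j + 1)) (g : ℝ → ℝ) {k : ℕ}
    (hk : k < N) {x : ℝ} (hx : x ∈ Set.Icc (xs k) (xs (k + 1))) :
    meshInterp N xs g x = g (xs k) - g (xs 0) +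
      (g (xs (k + 1)) - g (xs k)) / (xs (k + 1) - xs k) * (x - xs k) := by
  unfold meshInterp
  rw [← Finset.sum_subset (Finset.range_subset_range.2 (Nat.succ_le_of_lt hk)),
    Finset.sum_range_succ]
  · congr 1
    · rw [← Finset.sum_range_sub (fun j => g (xs j))]
      refine Finset.sum_congr rfl fun j hj => ?_
      have hjk := Finset.mem_range.1 hj
      have hm := hmono j (hjk.trans hk)
      have h1 : xs (j + 1) ≤ x := (mesh_le hmono hjk hk.le).trans hx.1
      rw [max_eq_left (hm.le.trans h1), min_eq_right h1, div_self (sub_pos.2 hm).ne', mul_one]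
    · rw [max_eq_left hx.1, min_eq_left hx.2]
      ring
  · intro j hj hjk
    have hjN := Finset.mem_range.1 hj
    have hkj : k + 1 ≤ j := by
      by_contra hn
      exact hjk (Finset.mem_range.2 (by omega))
    have h1 : x ≤ xs j := hx.2.trans (mesh_le hmono hkj hjN.le)
    rw [max_eq_right h1, min_eq_left (hmono j hjN).le]
    simp

theorem memVh_meshInterp {a b : ℝ} (hxa : xs 0 = a) (hxb : xs N = b)
    (hmono : ∀ j < N, xs j < xs (j + 1)) {g : ℝ → ℝ} (hga : g a = 0) (hgb : g b = 0) :
    MemVh a b N xs (meshInterp N xs g) := by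
  subst hxa hxb
  refine ⟨fun x hx => ?_, fun k hk => ?_⟩
  · rcases le_or_gt x (xs 0) with h | h
    · exact meshInterp_eq_zero_of_le hmono g h
    · rw [meshInterp_eq_of_ge hmono g (not_lt.1 fun h' => hx ⟨h, h'⟩), hga, hgb, sub_zero]
  · refine ⟨(g (xs (k + 1)) - g (xs k)) / (xs (k + 1) - xs k), g (xs k) - g (xs 0) -
      (g (xs (k + 1)) - g (xs k)) / (xs (k + 1) - xs k) * xs k, fun x hx => ?_⟩
    rw [meshInterp_eq_of_mem hmono g hk hx]
    ring

theorem continuous_meshInterp (N : ℕ) (xs : ℕ → ℝ) (g : ℝ → ℝ) :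
    Continuous (meshInterp N xs g) := by
  unfold meshInterp
  fun_prop

end Mesh

theorem ae_mem_Ioo_diff {a b : ℝ} {S : Set ℝ} (hS : S.Countable) :
    ∀ᵐ x ∂(volume.restrict (Set.Ioc a b)), x ∈ Set.Ioo a b \ S := by
  have h1 : ∀ᵐ x ∂(volume : Measure ℝ), x ∉ S ∪ {b} :=
    (hS.union (Set.countable_singleton b)).ae_notMem volume
  filter_upwards [ae_restrict_of_ae h1, ae_restrict_mem measurableSet_Ioc] with x hx hx'
  simp only [Set.mem_union, Set.mem_singleton_iff, not_or] at hx
  exact ⟨⟨hx'.1, lt_of_le_of_ne hx'.2 hx.2⟩, hx.1⟩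

theorem intervalIntegral_congr_off_countable {a b : ℝ} (hab : a ≤ b) {S : Set ℝ}
    (hS : S.Countable) {f g : ℝ → ℝ} (h : ∀ x ∈ Set.Ioo a b \ S, f x = g x) :
    ∫ x in a..b, f x = ∫ x in a..b, g x := by
  simp only [intervalIntegral.integral_of_le hab]
  refine integral_congr_ae ?_
  filter_upwards [ae_mem_Ioo_diff hS] with x hx using h x hx

/-- Continuity on `[a,b]` together with differentiability, with bounded derivative, at the
points of `(a,b)` outside the exceptional set `S`. -/
structure IsPiecewiseSmooth (a b : ℝ) (S : Set ℝ) (u : ℝ → ℝ) : Prop where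
  continuousOn : ContinuousOn u (Set.Icc a b)
  differentiableAt : ∀ x ∈ Set.Ioo a b \ S, DifferentiableAt ℝ u x
  exists_bound : ∃ C, ∀ x ∈ Set.Ioo a b \ S, |deriv u x| ≤ C

theorem memLp_of_continuousOn_Icc {a b : ℝ} {u : ℝ → ℝ} (hu : ContinuousOn u (Set.Icc a b))
    (p : ENNReal) : MemLp u p (volume.restrict (Set.Ioc a b)) := by
  obtain ⟨C, hC⟩ := isCompact_Icc.exists_bound_of_continuousOn hu
  refine MemLp.of_bound ((hu.mono Set.Ioc_subset_Icc_self).aestronglyMeasurable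
    measurableSet_Ioc) C ?_
  filter_upwards [ae_restrict_mem measurableSet_Ioc] with x hx
  exact hC x (Set.Ioc_subset_Icc_self hx)

theorem MeasureTheory.MemLp.intervalIntegrable {a b : ℝ} (hab : a ≤ b) {u : ℝ → ℝ}
    {p : ENNReal} (hp : 1 ≤ p) (hu : MemLp u p (volume.restrict (Set.Ioc a b))) :
    IntervalIntegrable u volume a b :=
  (intervalIntegrable_iff_integrableOn_Ioc_of_le hab).2 (hu.integrable hp)

namespace IsPiecewiseSmooth

variable {a b : ℝ} {S : Set ℝ} {u z : ℝ → ℝ}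

theorem memLp (hu : IsPiecewiseSmooth a b S u) (p : ENNReal) :
    MemLp u p (volume.restrict (Set.Ioc a b)) :=
  memLp_of_continuousOn_Icc hu.continuousOn p

theorem memLp_deriv (hu : IsPiecewiseSmooth a b S u) (hS : S.Countable) (p : ENNReal) :
    MemLp (deriv u) p (volume.restrict (Set.Ioc a b)) := by
  obtain ⟨C, hC⟩ := hu.exists_bound
  refine MemLp.of_bound (measurable_deriv u).aestronglyMeasurable C ?_
  filter_upwards [ae_mem_Ioo_diff hS] with x hx using hC x hx

theorem deriv_sub (hu : IsPiecewiseSmooth a b S u) (hz : IsPiecewiseSmooth a b S z)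
    {x : ℝ} (hx : x ∈ Set.Ioo a b \ S) :
    deriv (fun x => u x - z x) x = deriv u x - deriv z x :=
  deriv_fun_sub (hu.differentiableAt x hx) (hz.differentiableAt x hx)

theorem sub (hu : IsPiecewiseSmooth a b S u) (hz : IsPiecewiseSmooth a b S z) :
    IsPiecewiseSmooth a b S fun x => u x - z x := by
  refine ⟨hu.continuousOn.sub hz.continuousOn,
    fun x hx => (hu.differentiableAt x hx).sub (hz.differentiableAt x hx), ?_⟩
  obtain ⟨C, hC⟩ := hu.exists_bound
  obtain ⟨C', hC'⟩ := hz.exists_bound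
  refine ⟨C + C', fun x hx => ?_⟩
  rw [hu.deriv_sub hz hx]
  exact (abs_sub _ _).trans (add_le_add (hC x hx) (hC' x hx))

theorem of_hasDerivAt {u' : ℝ → ℝ} (hu : ContinuousOn u (Set.Icc a b))
    (hu' : ContinuousOn u' (Set.Icc a b)) (h : ∀ x ∈ Set.Ioo a b, HasDerivAt u (u' x) x) :
    IsPiecewiseSmooth a b S u := by
  obtain ⟨C, hC⟩ := isCompact_Icc.exists_bound_of_continuousOn hu'
  refine ⟨hu, fun x hx => (h x hx.1).differentiableAt, C, fun x hx => ?_⟩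
  rw [(h x hx.1).deriv]
  exact hC x (Set.Ioo_subset_Icc_self hx.1)

theorem L2norm_le (hab : a < b) (hS : S.Countable) (hu : IsPiecewiseSmooth a b S u)
    (hua : u a = 0) (hub : u b = 0) :
    L2norm a b u ≤ (b - a) / Real.sqrt 6 * L2norm a b (deriv u) := by
  have h := integral_sq_le_of_hasDerivAt hab hS hu.continuousOn hua hub
    (fun x hx => (hu.differentiableAt x hx).hasDerivAt)
    ((hu.memLp_deriv hS 1).intervalIntegrable hab.le le_rfl)
    ((intervalIntegrable_iff_integrableOn_Ioc_of_le hab.le).2 (hu.memLp_deriv hS 2).integrable_sq)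
  unfold L2norm
  refine (Real.sqrt_le_sqrt h).trans (le_of_eq ?_)
  rw [Real.sqrt_mul (by positivity), Real.sqrt_div (by positivity),
    Real.sqrt_sq (sub_pos.2 hab).le]

theorem intervalIntegrable_form (hab : a ≤ b) (hS : S.Countable)
    (hu : IsPiecewiseSmooth a b S u) (hz : IsPiecewiseSmooth a b S z) (s μ : ℝ) :
    IntervalIntegrable (fun x => s * deriv u x * deriv z x + μ * x * deriv u x * z x)
      volume a b := by
  have h1 : MemLp (fun x => s * deriv u x * deriv z x) ⊤ (volume.restrict (Set.Ioc a b)) :=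
    (hz.memLp_deriv hS ⊤).mul' ((hu.memLp_deriv hS ⊤).const_mul s)
  have h2 : MemLp (fun x => μ * x * deriv u x * z x) ⊤ (volume.restrict (Set.Ioc a b)) :=
    (hz.memLp ⊤).mul' (r := ⊤) ((hu.memLp_deriv hS ⊤).mul' (r := ⊤)
      (memLp_of_continuousOn_Icc (by fun_prop) ⊤ : MemLp (fun x => μ * x) ⊤ _))
  exact (h1.add h2).intervalIntegrable hab le_top

theorem intervalIntegrable_Iop_mul (hab : a ≤ b) {φ : ℝ → ℝ} (hφ : Continuous φ) (lam : ℝ)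
    (hu : Continuous u) (hz : IsPiecewiseSmooth a b S z) :
    IntervalIntegrable (fun x => Iop a b lam φ u x * z x) volume a b :=
  ContinuousOn.intervalIntegrable (by
    rw [Set.uIcc_of_le hab]
    exact (continuous_Iop a b lam hφ hu).continuousOn.mul hz.continuousOn)

theorem AbilD_sub_left (hab : a ≤ b) (hS : S.Countable) (σ μ lam : ℝ) {φ u₁ u₂ : ℝ → ℝ}
    (hφ : Continuous φ) (hu₁ : IsPiecewiseSmooth a b S u₁) (hu₂ : IsPiecewiseSmooth a b S u₂)
    (hc₁ : Continuous u₁) (hc₂ : Continuous u₂) (hz : IsPiecewiseSmooth a b S z) :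
    AbilD a b σ μ lam φ (fun x => u₁ x - u₂ x) z =
      AbilD a b σ μ lam φ u₁ z - AbilD a b σ μ lam φ u₂ z := by
  have hI : ∀ x, Iop a b lam φ (fun x => u₁ x - u₂ x) x =
      Iop a b lam φ u₁ x - Iop a b lam φ u₂ x := by
    intro x
    unfold Iop
    simp only [mul_sub]
    rw [intervalIntegral.integral_sub (Continuous.intervalIntegrable (by fun_prop) _ _)
      (Continuous.intervalIntegrable (by fun_prop) _ _)]
    ring
  have h1 := intervalIntegral_congr_off_countable hab hS
    (f := fun x => (σ ^ 2 / 2) * deriv (fun x => u₁ x - u₂ x) x * deriv z x +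
      μ * x * deriv (fun x => u₁ x - u₂ x) x * z x)
    (g := fun x => ((σ ^ 2 / 2) * deriv u₁ x * deriv z x + μ * x * deriv u₁ x * z x) -
      ((σ ^ 2 / 2) * deriv u₂ x * deriv z x + μ * x * deriv u₂ x * z x)) (fun x hx => by
        simp only [hu₁.deriv_sub hu₂ hx]; ring)
  unfold AbilD
  simp only [hI, sub_mul]
  rw [h1, intervalIntegral.integral_sub (hu₁.intervalIntegrable_form hab hS hz _ _)
    (hu₂.intervalIntegrable_form hab hS hz _ _),
    intervalIntegral.integral_sub (hz.intervalIntegrable_Iop_mul hab hφ lam hc₁)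
      (hz.intervalIntegrable_Iop_mul hab hφ lam hc₂)]
  ring

theorem AbilD_sub_right (hab : a ≤ b) (hS : S.Countable) (σ μ lam : ℝ) {φ z₁ z₂ : ℝ → ℝ}
    (hφ : Continuous φ) (hu : IsPiecewiseSmooth a b S u) (hc : Continuous u)
    (hz₁ : IsPiecewiseSmooth a b S z₁) (hz₂ : IsPiecewiseSmooth a b S z₂) :
    AbilD a b σ μ lam φ u (fun x => z₁ x - z₂ x) =
      AbilD a b σ μ lam φ u z₁ - AbilD a b σ μ lam φ u z₂ := by
  have h1 := intervalIntegral_congr_off_countable hab hS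
    (f := fun x => (σ ^ 2 / 2) * deriv u x * deriv (fun x => z₁ x - z₂ x) x +
      μ * x * deriv u x * (z₁ x - z₂ x))
    (g := fun x => ((σ ^ 2 / 2) * deriv u x * deriv z₁ x + μ * x * deriv u x * z₁ x) -
      ((σ ^ 2 / 2) * deriv u x * deriv z₂ x + μ * x * deriv u x * z₂ x)) (fun x hx => by
        simp only [hz₁.deriv_sub hz₂ hx]; ring)
  unfold AbilD
  simp only [mul_sub (Iop a b lam φ u _)]
  rw [h1, intervalIntegral.integral_sub (hu.intervalIntegrable_form hab hS hz₁ _ _)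
    (hu.intervalIntegrable_form hab hS hz₂ _ _),
    intervalIntegral.integral_sub (hz₁.intervalIntegrable_Iop_mul hab hφ lam hc)
      (hz₂.intervalIntegrable_Iop_mul hab hφ lam hc)]
  ring

end IsPiecewiseSmooth

theorem abs_integral_mul_le_L2norm {a b : ℝ} (hab : a ≤ b) {f g : ℝ → ℝ}
    (hf : MemLp f 2 (volume.restrict (Set.Ioc a b)))
    (hg : MemLp g 2 (volume.restrict (Set.Ioc a b))) :
    |∫ x in a..b, f x * g x| ≤ L2norm a b f * L2norm a b g := by
  unfold L2norm
  rw [← Real.sqrt_mul (intervalIntegral.integral_nonneg hab fun x _ => sq_nonneg (f x))]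
  exact Real.abs_le_sqrt (sq_intervalIntegral_mul_le hab hf hg)

theorem L2norm_le_mul {a b c : ℝ} (hc : 0 ≤ c) {f g : ℝ → ℝ}
    (h : ∫ x in a..b, f x ^ 2 ≤ c ^ 2 * ∫ x in a..b, g x ^ 2) :
    L2norm a b f ≤ c * L2norm a b g := by
  unfold L2norm
  refine (Real.sqrt_le_sqrt h).trans (le_of_eq ?_)
  rw [Real.sqrt_mul (sq_nonneg c), Real.sqrt_sq hc]

theorem AbilD_le {a b σ μ lam : ℝ} (hab : a ≤ b) (hμ : 0 ≤ μ) (hlam : 0 ≤ lam) {S : Set ℝ}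
    (hS : S.Countable) {φ u z : ℝ → ℝ} (hφc : Continuous φ) (hφ0 : ∀ y, 0 ≤ φ y)
    (hφ1 : (∫ y, φ y) = 1) (hu : IsPiecewiseSmooth a b S u) (huc : Continuous u)
    (hz : IsPiecewiseSmooth a b S z) :
    AbilD a b σ μ lam φ u z ≤ σ ^ 2 / 2 * (L2norm a b (deriv u) * L2norm a b (deriv z)) +
      μ * max |a| |b| * (L2norm a b (deriv u) * L2norm a b z) +
      2 * lam * (L2norm a b u * L2norm a b z) := by
  have hz0 : 0 ≤ L2norm a b z := Real.sqrt_nonneg _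
  have hM : 0 ≤ μ * max |a| |b| := mul_nonneg hμ ((abs_nonneg a).trans (le_max_left _ _))
  have hdu := hu.memLp_deriv hS 2
  have hdz := hz.memLp_deriv hS 2
  have hxu : MemLp (fun x => μ * x * deriv u x) 2 (volume.restrict (Set.Ioc a b)) :=
    hdu.mul' (r := 2) (memLp_of_continuousOn_Icc (by fun_prop) ⊤ : MemLp (fun x => μ * x) ⊤ _)
  have i1 : IntervalIntegrable (fun x => deriv u x * deriv z x) volume a b :=
    (intervalIntegrable_iff_integrableOn_Ioc_of_le hab).2 (hdu.integrable_mul hdz)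
  have i2 : IntervalIntegrable (fun x => μ * x * deriv u x * z x) volume a b :=
    (intervalIntegrable_iff_integrableOn_Ioc_of_le hab).2 (hxu.integrable_mul (hz.memLp 2))
  have hxu_le : L2norm a b (fun x => μ * x * deriv u x) ≤
      μ * max |a| |b| * L2norm a b (deriv u) := by
    refine L2norm_le_mul hM ?_
    rw [← intervalIntegral.integral_const_mul]
    refine intervalIntegral.integral_mono_on hab
      ((intervalIntegrable_iff_integrableOn_Ioc_of_le hab).2 hxu.integrable_sq)
      ((intervalIntegrable_iff_integrableOn_Ioc_of_le hab).2 (hdu.integrable_sq.const_mul _))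
      fun x hx => ?_
    have hxM : |x| ≤ max |a| |b| := abs_le_max_abs_abs hx.1 hx.2
    rw [mul_pow (μ * x)]
    refine mul_le_mul_of_nonneg_right ?_ (sq_nonneg _)
    rw [mul_pow, mul_pow, ← sq_abs x]
    gcongr
  have hI_le : L2norm a b (Iop a b lam φ u) ≤ 2 * lam * L2norm a b u :=
    L2norm_le_mul (by positivity) (integral_sq_Iop_le hab hφc hφ0 hφ1 huc)
  have b1 := (abs_le.1 (abs_integral_mul_le_L2norm hab hdu hdz)).2
  have b2 := (abs_le.1 (abs_integral_mul_le_L2norm hab hxu (hz.memLp 2))).2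
  have b3 := (abs_le.1 (abs_integral_mul_le_L2norm hab
    (memLp_of_continuousOn_Icc (continuous_Iop a b lam hφc huc).continuousOn 2) (hz.memLp 2))).1
  have b2' := b2.trans (mul_le_mul_of_nonneg_right hxu_le hz0)
  have b3' := mul_le_mul_of_nonneg_right hI_le hz0
  have b1' := mul_le_mul_of_nonneg_left b1 (by positivity : (0 : ℝ) ≤ σ ^ 2 / 2)
  unfold AbilD
  simp only [mul_assoc (σ ^ 2 / 2)]
  rw [intervalIntegral.integral_add (i1.const_mul _) i2, intervalIntegral.integral_const_mul]
  linarith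

section Galerkin

variable {a b : ℝ} {N : ℕ} {xs : ℕ → ℝ}

theorem MemVh.eq_meshInterp (hxa : xs 0 = a) (hxb : xs N = b)
    (hmono : ∀ j < N, xs j < xs (j + 1)) {g : ℝ → ℝ} (hg : MemVh a b N xs g) :
    g = meshInterp N xs g := by
  have hga : g a = 0 := hg.1 a (by simp)
  have hgb : g b = 0 := hg.1 b (by simp)
  funext x
  by_cases hx : x ∈ Set.Ioo a b
  · obtain ⟨k, hk, hxk⟩ := exists_mem_Ico_of_mesh (N := N) (xs := xs) (x := x)
      ⟨hxa ▸ hx.1.le, hxb ▸ hx.2⟩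
    have hm := hmono k hk
    obtain ⟨p, q, hpq⟩ := hg.2 k hk
    rw [meshInterp_eq_of_mem hmono g hk (Set.Ico_subset_Icc_self hxk), hxa, hga,
      hpq x (Set.Ico_subset_Icc_self hxk), hpq _ ⟨le_rfl, hm.le⟩, hpq _ ⟨hm.le, le_rfl⟩]
    have := (sub_pos.2 hm).ne'
    field_simp
    ring
  · rw [hg.1 x hx, (memVh_meshInterp hxa hxb hmono hga hgb).1 x hx]

theorem MemVh.continuous (hxa : xs 0 = a) (hxb : xs N = b)
    (hmono : ∀ j < N, xs j < xs (j + 1)) {g : ℝ → ℝ} (hg : MemVh a b N xs g) : Continuous g := by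
  rw [hg.eq_meshInterp hxa hxb hmono]
  exact continuous_meshInterp N xs g

theorem hasDerivAt_meshInterp (hmono : ∀ j < N, xs j < xs (j + 1)) (g : ℝ → ℝ) {k : ℕ}
    (hk : k < N) {x : ℝ} (hx : x ∈ Set.Ioo (xs k) (xs (k + 1))) :
    HasDerivAt (meshInterp N xs g) ((g (xs (k + 1)) - g (xs k)) / (xs (k + 1) - xs k)) x := by
  have h1 : HasDerivAt (fun x => g (xs k) - g (xs 0) +
      (g (xs (k + 1)) - g (xs k)) / (xs (k + 1) - xs k) * (x - xs k))
      ((g (xs (k + 1)) - g (xs k)) / (xs (k + 1) - xs k)) x := by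
    simpa using (((hasDerivAt_id x).sub_const (xs k)).const_mul
      ((g (xs (k + 1)) - g (xs k)) / (xs (k + 1) - xs k))).const_add (g (xs k) - g (xs 0))
  refine h1.congr_of_eventuallyEq ?_
  filter_upwards [isOpen_Ioo.mem_nhds hx] with y hy
  exact meshInterp_eq_of_mem hmono g hk (Set.Ioo_subset_Icc_self hy)

theorem exists_mem_Ioo_of_mesh (hxa : xs 0 = a) (hxb : xs N = b) {x : ℝ}
    (hx : x ∈ Set.Ioo a b \ Set.range xs) : ∃ j < N, x ∈ Set.Ioo (xs j) (xs (j + 1)) := by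
  obtain ⟨k, hk, hxk⟩ := exists_mem_Ico_of_mesh (N := N) (xs := xs) (x := x)
    ⟨hxa ▸ hx.1.1.le, hxb ▸ hx.1.2⟩
  exact ⟨k, hk, lt_of_le_of_ne hxk.1 fun h => hx.2 ⟨k, h⟩, hxk.2⟩

theorem isPiecewiseSmooth_meshInterp (hxa : xs 0 = a) (hxb : xs N = b)
    (hmono : ∀ j < N, xs j < xs (j + 1)) (g : ℝ → ℝ) :
    IsPiecewiseSmooth a b (Set.range xs) (meshInterp N xs g) := by
  refine ⟨(continuous_meshInterp N xs g).continuousOn, fun x hx => ?_,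
    ∑ j ∈ Finset.range N, |(g (xs (j + 1)) - g (xs j)) / (xs (j + 1) - xs j)|, fun x hx => ?_⟩
  · obtain ⟨k, hk, hxk⟩ := exists_mem_Ioo_of_mesh hxa hxb hx
    exact (hasDerivAt_meshInterp hmono g hk hxk).differentiableAt
  · obtain ⟨k, hk, hxk⟩ := exists_mem_Ioo_of_mesh hxa hxb hx
    rw [(hasDerivAt_meshInterp hmono g hk hxk).deriv]
    exact Finset.single_le_sum
      (f := fun j => |(g (xs (j + 1)) - g (xs j)) / (xs (j + 1) - xs j)|)
      (fun j _ => abs_nonneg _) (Finset.mem_range.2 hk)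

theorem MemVh.isPiecewiseSmooth (hxa : xs 0 = a) (hxb : xs N = b)
    (hmono : ∀ j < N, xs j < xs (j + 1)) {g : ℝ → ℝ} (hg : MemVh a b N xs g) :
    IsPiecewiseSmooth a b (Set.range xs) g := by
  rw [hg.eq_meshInterp hxa hxb hmono]
  exact isPiecewiseSmooth_meshInterp hxa hxb hmono g

theorem continuous_of_continuousOn_of_eq_zero (hab : a ≤ b) {u : ℝ → ℝ}
    (hu : ContinuousOn u (Set.Icc a b)) (h0 : ∀ x, x ∉ Set.Ioo a b → u x = 0) :
    Continuous u := by
  have h : u = Set.IccExtend hab (Set.domRestrict (Set.Icc a b) u) := by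
    funext x
    by_cases hx : x ∈ Set.Icc a b
    · rw [Set.IccExtend_of_mem hab _ hx]; rfl
    · rw [h0 x fun h => hx (Set.Ioo_subset_Icc_self h)]
      rcases lt_or_ge x a with h | h
      · rw [Set.IccExtend_of_le_left hab _ h.le]
        exact (h0 a (by simp)).symm
      · rw [Set.IccExtend_of_right_le hab _ (not_le.1 fun h' => hx ⟨h, h'⟩).le]
        exact (h0 b (by simp)).symm
  rw [h]
  exact hu.domRestrict.Icc_extend'

namespace IsClassicalSolution

variable {σ μ lam : ℝ} {φ f v : ℝ → ℝ}

theorem continuous (hab : a ≤ b) (hv : IsClassicalSolution a b σ μ lam φ f v) : Continuous v :=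
  continuous_of_continuousOn_of_eq_zero hab hv.2.1.continuousOn hv.1

theorem exists_deriv (hab : a < b) (hv : IsClassicalSolution a b σ μ lam φ f v) :
    ∃ v' v'' : ℝ → ℝ, ContinuousOn v' (Set.Icc a b) ∧ ContinuousOn v'' (Set.Icc a b) ∧
      (∀ x ∈ Set.Ioo a b, HasDerivAt v (v' x) x) ∧
      ∀ x ∈ Set.Ioo a b, HasDerivAt v' (v'' x) x := by
  have hU : UniqueDiffOn ℝ (Set.Icc a b) := uniqueDiffOn_Icc hab
  have h1 : ContDiffOn ℝ 1 (derivWithin v (Set.Icc a b)) (Set.Icc a b) :=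
    hv.2.1.derivWithin hU (by norm_num)
  have hder : ∀ {u : ℝ → ℝ}, DifferentiableOn ℝ u (Set.Icc a b) → ∀ x ∈ Set.Ioo a b,
      HasDerivAt u (derivWithin u (Set.Icc a b) x) x := fun hu x hx =>
    (hu x (Set.Ioo_subset_Icc_self hx)).hasDerivWithinAt.hasDerivAt (Icc_mem_nhds hx.1 hx.2)
  exact ⟨derivWithin v (Set.Icc a b), derivWithin (derivWithin v (Set.Icc a b)) (Set.Icc a b),
    h1.continuousOn, h1.continuousOn_derivWithin hU le_rfl,
    hder (hv.2.1.differentiableOn (by norm_num)), hder (h1.differentiableOn (by norm_num))⟩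

/-- A classical solution satisfies the variational equation against test functions vanishing at
the end points. -/
theorem AbilD_eq (hab : a < b) (hf : ContinuousOn f (Set.Icc a b)) (hφ : Continuous φ)
    (hv : IsClassicalSolution a b σ μ lam φ f v) {S : Set ℝ} (hS : S.Countable) {z : ℝ → ℝ}
    (hz : IsPiecewiseSmooth a b S z) (hza : z a = 0) (hzb : z b = 0) :
    AbilD a b σ μ lam φ v z = ∫ x in a..b, f x * z x := by
  obtain ⟨v', v'', hv'c, hv''c, hv', hv''⟩ := hv.exists_deriv hab
  have hvs : IsPiecewiseSmooth a b S v :=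
    .of_hasDerivAt hv.2.1.continuousOn hv'c hv'
  have hparts : ∫ x in a..b, (v'' x * z x + v' x * deriv z x) = 0 := by
    rw [integral_eq_of_hasDerivAt_off_countable_of_le (fun x => v' x * z x) _ hab.le hS
      (hv'c.mul hz.continuousOn)
      (fun x hx => (hv'' x hx.1).mul (hz.differentiableAt x hx).hasDerivAt), hza, hzb]
    · ring
    · have m1 : MemLp (fun x => v'' x * z x) ⊤ (volume.restrict (Set.Ioc a b)) :=
        memLp_of_continuousOn_Icc (hv''c.mul hz.continuousOn) ⊤
      have m2 : MemLp (fun x => v' x * deriv z x) ⊤ (volume.restrict (Set.Ioc a b)) :=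
        (hz.memLp_deriv hS ⊤).mul' (memLp_of_continuousOn_Icc hv'c ⊤)
      exact (m1.add m2).intervalIntegrable hab.le le_top
  have hfz : IntervalIntegrable (fun x => f x * z x) volume a b :=
    ContinuousOn.intervalIntegrable (by rw [Set.uIcc_of_le hab.le]; exact hf.mul hz.continuousOn)
  have hF := hvs.intervalIntegrable_form hab.le hS hz (σ ^ 2 / 2) μ
  have hI := hz.intervalIntegrable_Iop_mul hab.le hφ lam (hv.continuous hab.le)
  rw [← sub_eq_zero, AbilD, ← intervalIntegral.integral_sub hF hI,
    ← intervalIntegral.integral_sub (hF.sub hI) hfz]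
  rw [intervalIntegral_congr_off_countable hab.le hS
    (g := fun x => σ ^ 2 / 2 * (v'' x * z x + v' x * deriv z x)),
    intervalIntegral.integral_const_mul, hparts, mul_zero]
  intro x hx
  have hd2 : deriv (deriv v) x = v'' x := by
    have : deriv v =ᶠ[nhds x] v' := by
      filter_upwards [isOpen_Ioo.mem_nhds hx.1] with y hy using (hv' y hy).deriv
    rw [this.deriv_eq, (hv'' x hx.1).deriv]
  have heq := hv.2.2 x hx.1
  rw [hd2, (hv' x hx.1).deriv] at heq
  rw [(hv' x hx.1).deriv, ← heq]
  ring

end IsClassicalSolution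

/-- The `H¹` seminorm estimate for piecewise affine interpolation. -/
theorem L2norm_deriv_sub_meshInterp_le (hab : a < b) (hxa : xs 0 = a) (hxb : xs N = b)
    (hmono : ∀ j < N, xs j < xs (j + 1)) {h : ℝ} (hh0 : 0 ≤ h)
    (hh : ∀ j < N, xs (j + 1) - xs j ≤ h) {w w' w'' : ℝ → ℝ}
    (hw : ContinuousOn w (Set.Icc a b)) (hw' : ∀ x ∈ Set.Ioo a b, HasDerivAt w (w' x) x)
    (hw'c : ContinuousOn w' (Set.Icc a b))
    (hAC : ∀ x ∈ Set.Icc a b, w' x = w' a + ∫ t in a..x, w'' t)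
    (hi2 : IntervalIntegrable (fun x => w'' x ^ 2) volume a b) :
    L2norm a b (deriv fun x => w x - meshInterp N xs w x) ≤ h / Real.sqrt 3 * L2norm a b w'' := by
  have hS : (Set.range xs).Countable := Set.countable_range xs
  have hη := (IsPiecewiseSmooth.of_hasDerivAt (S := Set.range xs) hw hw'c hw').sub
    (isPiecewiseSmooth_meshInterp hxa hxb hmono w)
  have hiη : IntervalIntegrable (fun x => deriv (fun x => w x - meshInterp N xs w x) x ^ 2)
      volume a b := (intervalIntegrable_iff_integrableOn_Ioc_of_le hab.le).2
    (hη.memLp_deriv hS 2).integrable_sq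
  have hge : ∀ j ≤ N, a ≤ xs j := fun j hj => hxa ▸ mesh_le hmono (Nat.zero_le j) hj
  have hle : ∀ j ≤ N, xs j ≤ b := fun j hj => hxb ▸ mesh_le hmono hj le_rfl
  have hsub : ∀ j < N, Set.uIcc (xs j) (xs (j + 1)) ⊆ Set.uIcc a b := by
    intro j hj
    rw [Set.uIcc_of_le (hmono j hj).le, Set.uIcc_of_le hab.le]
    exact Set.Icc_subset_Icc (hge j hj.le) (hle (j + 1) hj)
  have hel : ∀ j < N, ∫ x in xs j..xs (j + 1), deriv (fun x => w x - meshInterp N xs w x) x ^ 2 ≤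
      h ^ 2 / 3 * ∫ x in xs j..xs (j + 1), w'' x ^ 2 := by
    intro j hj
    have hm := hmono j hj
    have ha := hge j hj.le
    have hb := hle (j + 1) hj
    have hIcc : Set.Icc (xs j) (xs (j + 1)) ⊆ Set.Icc a b := Set.Icc_subset_Icc ha hb
    set D := ∫ x in xs j..xs (j + 1), w'' x ^ 2
    have hD0 : 0 ≤ D := intervalIntegral.integral_nonneg hm.le fun x _ => sq_nonneg _
    have hinc : ∀ x y, xs j ≤ x → x ≤ y → y ≤ xs (j + 1) → (w' y - w' x) ^ 2 ≤ (y - x) * D := by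
      intro x y h1 h2 h3
      refine (sq_sub_le_of_eq_add_integral hw'c hAC hi2 (ha.trans h1) h2 (h3.trans hb)).trans
        (mul_le_mul_of_nonneg_left ?_ (sub_nonneg.2 h2))
      exact intervalIntegral.integral_mono_interval h1 h2 h3
        (Filter.Eventually.of_forall fun t => sq_nonneg _) (hi2.mono_set (hsub j hj))
    have hmean : ∫ y in xs j..xs (j + 1), w' y = (xs (j + 1) - xs j) *
        ((w (xs (j + 1)) - w (xs j)) / (xs (j + 1) - xs j)) := by
      rw [mul_div_cancel₀ _ (sub_pos.2 hm).ne']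
      refine integral_eq_of_hasDerivAt_off_countable_of_le w w' hm.le Set.countable_empty
        (hw.mono hIcc) (fun x hx => hw' x ⟨ha.trans_lt hx.1.1, hx.1.2.trans_le hb⟩) ?_
      exact ContinuousOn.intervalIntegrable
        (by rw [Set.uIcc_of_le hm.le]; exact hw'c.mono hIcc)
    have key := integral_sq_sub_mean_le hm (hw'c.mono hIcc) (D := D) (fun x hx y hy => by
      rcases le_total x y with hxy | hxy
      · rw [abs_sub_comm, abs_of_nonneg (sub_nonneg.2 hxy), ← neg_sub, neg_sq]
        exact hinc x y hx.1 hxy hy.2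
      · rw [abs_of_nonneg (sub_nonneg.2 hxy)]
        exact hinc y x hy.1 hxy hx.2) hmean
    rw [intervalIntegral_congr_off_countable hm.le Set.countable_empty (g := fun x =>
      (w' x - (w (xs (j + 1)) - w (xs j)) / (xs (j + 1) - xs j)) ^ 2)]
    · refine key.trans (mul_le_mul_of_nonneg_right ?_ hD0)
      have := hh j hj
      have := sub_pos.2 hm
      gcongr
    · intro x hx
      have hx' : x ∈ Set.Ioo a b := ⟨ha.trans_lt hx.1.1, hx.1.2.trans_le hb⟩
      rw [((hw' x hx').fun_sub (hasDerivAt_meshInterp hmono w hj hx.1)).deriv]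
  refine L2norm_le_mul (by positivity) ?_
  rw [div_pow, Real.sq_sqrt (by norm_num)]
  have e1 := intervalIntegral.sum_integral_adjacent_intervals (a := xs) (n := N)
    fun j hj => hiη.mono_set (hsub j hj)
  have e2 := intervalIntegral.sum_integral_adjacent_intervals (a := xs) (n := N)
    fun j hj => hi2.mono_set (hsub j hj)
  rw [hxa, hxb] at e1 e2
  rw [← e1, ← e2, Finset.mul_sum]
  exact Finset.sum_le_sum fun j hj => hel j (Finset.mem_range.1 hj)

end Galerkin

/-- Combines the continuity estimate for the bilinear form with the Poincaré and interpolation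
estimates; the constants `1/√6` and `1/√3` are absorbed by the powers of `1/π`. -/
theorem duality_bound {L σ M lam h c E E' H H' : ℝ} (hL : 0 < L) (hσ : 0 < σ) (hM : 0 ≤ M)
    (hlam : 0 < lam) (hh : 0 < h) (hc : 0 < c) (hE : 0 ≤ E) (hE' : 0 ≤ E') (hH : 0 ≤ H)
    (hA : E ^ 2 ≤ σ ^ 2 / 2 * (E' * H') + M * (E' * H) + 2 * lam * (E * H))
    (hPE : E ≤ L / Real.sqrt 6 * E') (hPH : H ≤ L / Real.sqrt 6 * H')
    (hI : H' ≤ h / Real.sqrt 3 * (c * E)) :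
    E ≤ (σ ^ 2 / 2 + (L / Real.pi) * (M + 2 * lam * (L / Real.pi))) * c * h * E' := by
  set K := E' * (h * c * E)
  have hK : 0 ≤ K := by positivity
  have hpi : 0 < Real.pi := Real.pi_pos
  have hpi2 : Real.pi ^ 2 ≤ 9.93 := by nlinarith [Real.pi_lt_d2]
  have s3 : 0 < Real.sqrt 3 := by positivity
  have s6 : 0 < Real.sqrt 6 := by positivity
  have hs3 : 1.7 ≤ Real.sqrt 3 := Real.le_sqrt_of_sq_le (by norm_num)
  have hs6 : 2.4 ≤ Real.sqrt 6 := Real.le_sqrt_of_sq_le (by norm_num)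
  have b1 : E' * H' ≤ 1 / Real.sqrt 3 * K := by
    refine (mul_le_mul_of_nonneg_left hI hE').trans (le_of_eq ?_)
    simp only [K]; ring
  have b2 : E' * H ≤ L / Real.sqrt 6 * (1 / Real.sqrt 3 * K) := by
    refine (mul_le_mul_of_nonneg_left hPH hE').trans ?_
    calc E' * (L / Real.sqrt 6 * H') = L / Real.sqrt 6 * (E' * H') := by ring
      _ ≤ _ := mul_le_mul_of_nonneg_left b1 (by positivity)
  have b3 : E * H ≤ L / Real.sqrt 6 * (L / Real.sqrt 6 * (1 / Real.sqrt 3 * K)) := by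
    refine (mul_le_mul_of_nonneg_right hPE hH).trans ?_
    rw [mul_assoc]
    exact mul_le_mul_of_nonneg_left b2 (by positivity)
  have k1 : 1 / Real.sqrt 3 ≤ 1 := by
    rw [div_le_one s3]; linarith
  have k2 : L / Real.sqrt 6 * (1 / Real.sqrt 3) ≤ L / Real.pi := by
    rw [div_mul_div_comm, mul_one]
    refine div_le_div_of_nonneg_left hL.le hpi ?_
    nlinarith [Real.pi_lt_d2]
  have k3 : L / Real.sqrt 6 * (L / Real.sqrt 6 * (1 / Real.sqrt 3)) ≤
      L / Real.pi * (L / Real.pi) := by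
    have e : L / Real.sqrt 6 * (L / Real.sqrt 6 * (1 / Real.sqrt 3)) =
        L * L / (6 * Real.sqrt 3) := by
      rw [← mul_assoc, div_mul_div_comm, Real.mul_self_sqrt (by norm_num), div_mul_div_comm,
        mul_one]
    rw [e, div_mul_div_comm]
    refine div_le_div_of_nonneg_left (by positivity) (by positivity) ?_
    nlinarith
  have t1 := mul_le_mul_of_nonneg_left
    (b1.trans (mul_le_mul_of_nonneg_right k1 hK)) (by positivity : 0 ≤ σ ^ 2 / 2)
  have t2 := mul_le_mul_of_nonneg_left
    (b2.trans (le_of_eq_of_le (by ring) (mul_le_mul_of_nonneg_right k2 hK))) hM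
  have t3 := mul_le_mul_of_nonneg_left
    (b3.trans (le_of_eq_of_le (by ring) (mul_le_mul_of_nonneg_right k3 hK)))
    (by positivity : 0 ≤ 2 * lam)
  have hfin : E * E ≤
      ((σ ^ 2 / 2 + (L / Real.pi) * (M + 2 * lam * (L / Real.pi))) * c * h * E') * E := by
    calc E * E = E ^ 2 := by ring
      _ ≤ σ ^ 2 / 2 * (1 * K) + M * (L / Real.pi * K) +
          2 * lam * (L / Real.pi * (L / Real.pi) * K) := hA.trans (by linarith)
      _ = _ := by simp only [K]; ring
  rcases hE.eq_or_lt with h0 | h0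
  · rw [← h0]; positivity
  · exact le_of_mul_le_mul_right hfin h0

/-- Duality (Aubin–Nitsche) argument: if `e = v − v_h` is the Galerkin error and `w` solves
the adjoint problem with data `e` (expressed weakly via the adjoint identity) with
`‖w''‖ ≤ c₃‖e‖`, then `‖e‖ ≤ c₁c₃h‖e'‖`. -/
theorem stmt14 (a b σ μ lam : ℝ) (hab : a < b) (hσ : 0 < σ) (hμ : 0 < μ) (hlam : 0 < lam)
    (φ : ℝ → ℝ) (hφc : Continuous φ) (hφ0 : ∀ y, 0 ≤ φ y) (hφ1 : (∫ y, φ y) = 1)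
    (N : ℕ) (hN : 0 < N) (xs : ℕ → ℝ)
    (hxa : xs 0 = a) (hxb : xs N = b) (hmono : ∀ j < N, xs j < xs (j + 1))
    (h : ℝ)
    (hh : h = (Finset.range N).sup' (Finset.nonempty_range_iff.mpr hN.ne')
      (fun j => xs (j + 1) - xs j))
    (f : ℝ → ℝ) (hf : ContinuousOn f (Set.Icc a b))
    (v : ℝ → ℝ) (hv : IsClassicalSolution a b σ μ lam φ f v)
    (vh : ℝ → ℝ) (hvh : IsGalerkinSolution a b σ μ lam φ f N xs vh)
    (c₃ : ℝ) (hc₃ : 0 < c₃)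
    (w w' w'' : ℝ → ℝ)
    (hw_cont : ContinuousOn w (Set.Icc a b)) (hwa : w a = 0) (hwb : w b = 0)
    (hw' : ∀ x ∈ Set.Ioo a b, HasDerivAt w (w' x) x)
    (hw'c : ContinuousOn w' (Set.Icc a b))
    (hAC : ∀ x ∈ Set.Icc a b, w' x = w' a + ∫ t in a..x, w'' t)
    (hw''L2 : IntegrableOn (fun x => (w'' x) ^ 2) (Set.Ioo a b))
    (hadj : ∀ ψ : ℝ → ℝ, IsPiecewiseC1Test a b ψ →
      AbilD a b σ μ lam φ ψ w = ∫ x in a..b, ψ x * (v x - vh x))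
    (hw'' : L2norm a b w'' ≤ c₃ * L2norm a b (fun x => v x - vh x)) :
    L2norm a b (fun x => v x - vh x) ≤
      (σ ^ 2 / 2 + ((b - a) / Real.pi) * (μ * max |a| |b| + 2 * lam * ((b - a) / Real.pi))) *
        c₃ * h * L2norm a b (deriv (fun x => v x - vh x)) := by

  have hS : (Set.range xs).Countable := Set.countable_range xs
  have hhj : ∀ j < N, xs (j + 1) - xs j ≤ h := fun j hj => by
    rw [hh]
    exact Finset.le_sup' (fun j => xs (j + 1) - xs j) (Finset.mem_range.2 hj)
  have hh0 : 0 < h := (sub_pos.2 (hmono 0 hN)).trans_le (hhj 0 hN)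
  have hba : 0 < b - a := sub_pos.2 hab
  have hi2 : IntervalIntegrable (fun x => w'' x ^ 2) volume a b := by
    rwa [intervalIntegrable_iff_integrableOn_Ioc_of_le hab.le, integrableOn_Ioc_iff_integrableOn_Ioo]
  obtain ⟨v', -, hv'c, -, hv', -⟩ := hv.exists_deriv hab
  have hvs : IsPiecewiseSmooth a b (Set.range xs) v :=
    .of_hasDerivAt hv.2.1.continuousOn hv'c hv'
  have hvc := hv.continuous hab.le
  have hvhs := hvh.1.isPiecewiseSmooth hxa hxb hmono
  have hvhc := hvh.1.continuous hxa hxb hmono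
  have hws : IsPiecewiseSmooth a b (Set.range xs) w := .of_hasDerivAt hw_cont hw'c hw'
  have hwh := memVh_meshInterp hxa hxb hmono hwa hwb
  have hwhs := hwh.isPiecewiseSmooth hxa hxb hmono
  have hes := hvs.sub hvhs
  have hec : Continuous fun x => v x - vh x := hvc.sub hvhc
  have he0 : ∀ x, x ∉ Set.Ioo a b → v x - vh x = 0 := fun x hx => by
    rw [hv.1 x hx, hvh.1.1 x hx, sub_zero]
  have hηs := hws.sub hwhs
  have horth : AbilD a b σ μ lam φ (fun x => v x - vh x) (meshInterp N xs w) = 0 := by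
    rw [IsPiecewiseSmooth.AbilD_sub_left hab.le hS σ μ lam hφc hvs hvhs hvc hvhc hwhs,
      hv.AbilD_eq hab hf hφc hS hwhs (hwh.1 a (by simp)) (hwh.1 b (by simp)), hvh.2 _ hwh, sub_self]
  have htest : IsPiecewiseC1Test a b fun x => v x - vh x := by
    refine ⟨hec.continuousOn, he0, N, hN, xs, hxa, hxb, hmono, fun j hj => ?_⟩
    obtain ⟨p, q, hpq⟩ := hvh.1.2 j hj
    have hsub : Set.Icc (xs j) (xs (j + 1)) ⊆ Set.Icc a b :=
      Set.Icc_subset_Icc (hxa ▸ mesh_le hmono (Nat.zero_le j) hj.le)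
        (hxb ▸ mesh_le hmono (Nat.succ_le_of_lt hj) le_rfl)
    have haff : ContDiffOn ℝ 1 (fun x => p * x + q) (Set.Icc (xs j) (xs (j + 1))) := by fun_prop
    exact ((hv.2.1.mono hsub).of_le (by norm_num)).sub (haff.congr hpq)
  have hE2 : L2norm a b (fun x => v x - vh x) ^ 2 =
      AbilD a b σ μ lam φ (fun x => v x - vh x) (fun x => w x - meshInterp N xs w x) := by
    rw [IsPiecewiseSmooth.AbilD_sub_right hab.le hS σ μ lam hφc hes hec hws hwhs, horth, sub_zero,
      hadj _ htest, L2norm, Real.sq_sqrt (intervalIntegral.integral_nonneg hab.le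
        fun x _ => sq_nonneg _)]
    simp only [pow_two]
  have hA := AbilD_le (σ := σ) hab.le hμ.le hlam.le hS hφc hφ0 hφ1 hes hec hηs
  have hPe := hes.L2norm_le hab hS (he0 a (by simp)) (he0 b (by simp))
  have hPη := hηs.L2norm_le hab hS (by rw [hwa, hwh.1 a (by simp), sub_zero])
    (by rw [hwb, hwh.1 b (by simp), sub_zero])
  have hH := L2norm_deriv_sub_meshInterp_le hab hxa hxb hmono hh0.le hhj hw_cont hw' hw'c hAC hi2
  rw [← hE2] at hA
  have nE : 0 ≤ L2norm a b (fun x => v x - vh x) := Real.sqrt_nonneg _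
  have nE' : 0 ≤ L2norm a b (deriv fun x => v x - vh x) := Real.sqrt_nonneg _
  have nH : 0 ≤ L2norm a b (fun x => w x - meshInterp N xs w x) := Real.sqrt_nonneg _
  have hM : 0 ≤ μ * max |a| |b| := mul_nonneg hμ.le ((abs_nonneg a).trans (le_max_left _ _))
  exact duality_bound hba hσ hM hlam hh0 hc₃ nE nE' nH hA hPe hPη
    (hH.trans (mul_le_mul_of_nonneg_left hw'' (by positivity)))
end
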